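/- (Existence and uniqueness for the Hamilton–Jacobi problem on a junction) Assume (A0) and (A1′) and let T > 0. Then there exists a unique viscosity solution u of (HJ)-(CI) on [0,T)×J satisfying, for some constant C_T > 0, |u(t,y) − u₀(y)| ≤ C_T for all (t,y) ∈ [0,T)×J; moreover u is Lipschitz continuous with respect to (t,y) on (0,T)×J. -/

import Mathlib

open Set Filter

/-- Assumption (A1) for a single Hamiltonian: `H` is `C¹`, coercive
(`H p → +∞` as `|p| → +∞`), non-increasing on `(-∞, p₀]` and non-decreasing on `[p₀, +∞)`. -/
def A1cond (H : ℝ → ℝ) (p₀ : ℝ) : Prop :=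
  ContDiff ℝ 1 H ∧ Tendsto H (cocompact ℝ) atTop ∧
    AntitoneOn H (Iic p₀) ∧ MonotoneOn H (Ici p₀)

/-- The non-increasing envelope `H⁻` of `H` with turning point `p₀`. -/
noncomputable def Hm (H : ℝ → ℝ) (p₀ : ℝ) (p : ℝ) : ℝ :=
  if p ≤ p₀ then H p else H p₀

/-- The non-decreasing envelope `H⁺` of `H` with turning point `p₀`. -/
noncomputable def Hp (H : ℝ → ℝ) (p₀ : ℝ) (p : ℝ) : ℝ :=
  if p ≤ p₀ then H p₀ else H p

/-- One time step of the numerical scheme (NS) on the junction: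
`V` (the values at time `n+1`) is computed from `U` (the values at time `n`).
For `i ≥ 1` on each branch `α` the update uses
`max (H⁺_α(p_{i,-}), H⁻_α(p_{i,+}))`; at the junction point `i = 0` all branches share a
common value and the update uses `max_β H⁻_β(p^β_{0,+})`. -/
def SchemeStep {N : ℕ} (H : Fin N → ℝ → ℝ) (p₀ : Fin N → ℝ) (Δx Δt : ℝ)
    (U V : Fin N → ℕ → ℝ) : Prop :=
  (∀ (α : Fin N) (i : ℕ), 1 ≤ i →
      V α i = U α i - Δt * max (Hp (H α) (p₀ α) ((U α i - U α (i - 1)) / Δx))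
        (Hm (H α) (p₀ α) ((U α (i + 1) - U α i) / Δx))) ∧
  (∀ α β : Fin N, U α 0 = U β 0) ∧
  (∀ α : Fin N, V α 0 = U α 0 - Δt *
      sSup (Set.range fun β : Fin N => Hm (H β) (p₀ β) ((U β 1 - U β 0) / Δx)))

/-- The numerical scheme (NS): `U α n i` is the value on branch `α` at time step `n`
and grid point `i`. -/
def SchemeNS {N : ℕ} (H : Fin N → ℝ → ℝ) (p₀ : Fin N → ℝ) (Δx Δt : ℝ)
    (U : Fin N → ℕ → ℕ → ℝ) : Prop :=
  ∀ n : ℕ, SchemeStep H p₀ Δx Δt (fun α i => U α n i) (fun α i => U α (n + 1) i)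

/-- Viscosity subsolution of the Hamilton–Jacobi equation (HJ) on the junction, on
`J_T = (0,T) × J`. The junction is encoded by the family of branch restrictions
`u α t x` (`x ≥ 0`), sharing a common value at the junction point `x = 0`. -/
def IsViscSubSol {N : ℕ} (T : ℝ) (H : Fin N → ℝ → ℝ) (p₀ : Fin N → ℝ)
    (u : Fin N → ℝ → ℝ → ℝ) : Prop :=
  (∀ α, UpperSemicontinuousOn (fun q : ℝ × ℝ => u α q.1 q.2) (Ico 0 T ×ˢ Ici 0)) ∧
  (∀ (α β : Fin N) (t : ℝ), u α t 0 = u β t 0) ∧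
  (∀ φ : Fin N → ℝ → ℝ → ℝ,
    (∀ α, ContDiffOn ℝ 1 (fun q : ℝ × ℝ => φ α q.1 q.2) (Ioo 0 T ×ˢ Ici 0)) →
    (∀ (α β : Fin N) (t : ℝ), φ α t 0 = φ β t 0) →
    (∀ (β : Fin N) (t x : ℝ), t ∈ Ioo 0 T → 0 ≤ x → u β t x ≤ φ β t x) →
    ((∀ (α : Fin N) (t x : ℝ), t ∈ Ioo 0 T → 0 < x → u α t x = φ α t x →
        deriv (fun s => φ α s x) t
          + H α (derivWithin (fun y => φ α t y) (Ici 0) x) ≤ 0) ∧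
     (∀ t : ℝ, t ∈ Ioo 0 T → (∀ α : Fin N, u α t 0 = φ α t 0) → ∀ α : Fin N,
        deriv (fun s => φ α s 0) t
          + sSup (Set.range fun β : Fin N =>
              Hm (H β) (p₀ β) (derivWithin (fun y => φ β t y) (Ici 0) 0)) ≤ 0)))

/-- Viscosity supersolution of (HJ) on the junction, on `J_T = (0,T) × J`. -/
def IsViscSuperSol {N : ℕ} (T : ℝ) (H : Fin N → ℝ → ℝ) (p₀ : Fin N → ℝ)
    (u : Fin N → ℝ → ℝ → ℝ) : Prop :=
  (∀ α, LowerSemicontinuousOn (fun q : ℝ × ℝ => u α q.1 q.2) (Ico 0 T ×ˢ Ici 0)) ∧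
  (∀ (α β : Fin N) (t : ℝ), u α t 0 = u β t 0) ∧
  (∀ φ : Fin N → ℝ → ℝ → ℝ,
    (∀ α, ContDiffOn ℝ 1 (fun q : ℝ × ℝ => φ α q.1 q.2) (Ioo 0 T ×ˢ Ici 0)) →
    (∀ (α β : Fin N) (t : ℝ), φ α t 0 = φ β t 0) →
    (∀ (β : Fin N) (t x : ℝ), t ∈ Ioo 0 T → 0 ≤ x → φ β t x ≤ u β t x) →
    ((∀ (α : Fin N) (t x : ℝ), t ∈ Ioo 0 T → 0 < x → u α t x = φ α t x →
        0 ≤ deriv (fun s => φ α s x) t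
          + H α (derivWithin (fun y => φ α t y) (Ici 0) x)) ∧
     (∀ t : ℝ, t ∈ Ioo 0 T → (∀ α : Fin N, u α t 0 = φ α t 0) → ∀ α : Fin N,
        0 ≤ deriv (fun s => φ α s 0) t
          + sSup (Set.range fun β : Fin N =>
              Hm (H β) (p₀ β) (derivWithin (fun y => φ β t y) (Ici 0) 0)))))

/-- Viscosity subsolution of (HJ)-(CI): subsolution of (HJ) on `J_T` with
`u(0,·) ≤ u₀` on `J`. -/
def IsViscSubSolCI {N : ℕ} (T : ℝ) (H : Fin N → ℝ → ℝ) (p₀ : Fin N → ℝ)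
    (u₀ : Fin N → ℝ → ℝ) (u : Fin N → ℝ → ℝ → ℝ) : Prop :=
  IsViscSubSol T H p₀ u ∧ ∀ (α : Fin N) (x : ℝ), 0 ≤ x → u α 0 x ≤ u₀ α x

/-- Viscosity supersolution of (HJ)-(CI): supersolution of (HJ) on `J_T` with
`u(0,·) ≥ u₀` on `J`. -/
def IsViscSuperSolCI {N : ℕ} (T : ℝ) (H : Fin N → ℝ → ℝ) (p₀ : Fin N → ℝ)
    (u₀ : Fin N → ℝ → ℝ) (u : Fin N → ℝ → ℝ → ℝ) : Prop :=
  IsViscSuperSol T H p₀ u ∧ ∀ (α : Fin N) (x : ℝ), 0 ≤ x → u₀ α x ≤ u α 0 x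

/-- Viscosity solution of (HJ)-(CI) on `[0,T) × J`. -/
def IsViscSolCI {N : ℕ} (T : ℝ) (H : Fin N → ℝ → ℝ) (p₀ : Fin N → ℝ)
    (u₀ : Fin N → ℝ → ℝ) (u : Fin N → ℝ → ℝ → ℝ) : Prop :=
  IsViscSubSolCI T H p₀ u₀ u ∧ IsViscSuperSolCI T H p₀ u₀ u

/-- Assumption (A0): Lipschitz initial data on each branch, with a common value at the
junction point. -/
def A0cond {N : ℕ} (u₀ : Fin N → ℝ → ℝ) : Prop :=
  (∀ α, ∃ C : NNReal, LipschitzOnWith C (u₀ α) (Ici 0)) ∧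
  (∀ α β : Fin N, u₀ α 0 = u₀ β 0)

/-- Assumption (A1′): each `H_α` is the Legendre–Fenchel transform of a uniformly convex
`C²` Lagrangian `L_α`, and `H⁻_α`, `H⁺_α` are the corresponding one-sided transforms. -/
def A1primeCond {N : ℕ} (H : Fin N → ℝ → ℝ) (p₀ : Fin N → ℝ) : Prop :=
  ∃ (γ : ℝ) (L : Fin N → ℝ → ℝ), 0 < γ ∧
    (∀ α, ContDiff ℝ 2 (L α)) ∧
    (∀ (α : Fin N) (q : ℝ), γ ≤ deriv (deriv (L α)) q) ∧
    (∀ (α : Fin N) (p : ℝ), H α p = sSup (Set.range fun q : ℝ => p * q - L α q)) ∧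
    (∀ (α : Fin N) (p : ℝ),
      Hm (H α) (p₀ α) p = sSup ((fun q : ℝ => p * q - L α q) '' Iic 0)) ∧
    (∀ (α : Fin N) (p : ℝ),
      Hp (H α) (p₀ α) p = sSup ((fun q : ℝ => p * q - L α q) '' Ici 0))

/-- The CFL condition (CFL′) for the scheme (NS): `Δx/Δt` dominates `|H'_α|` on
`[p̲_α, p̄_α]`, where `p̲_α, p̄_α` are determined by the level `-m⁰`,
`m⁰ = inf_{β,i} W^{β,0}_i`. -/
def CFLprime {N : ℕ} (H : Fin N → ℝ → ℝ) (p₀ : Fin N → ℝ) (Δx Δt : ℝ)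
    (U : Fin N → ℕ → ℕ → ℝ) : Prop :=
  ∀ α : Fin N, ∀ p ∈ Icc
      (sInf {p : ℝ | Hm (H α) (p₀ α) p =
        -(sInf (Set.range fun q : Fin N × ℕ => (U q.1 1 q.2 - U q.1 0 q.2) / Δt))})
      (sSup {p : ℝ | Hp (H α) (p₀ α) p =
        -(sInf (Set.range fun q : Fin N × ℕ => (U q.1 1 q.2 - U q.1 0 q.2) / Δt))}),
    |deriv (H α) p| ≤ Δx / Δt


/-! ### The action inequality and the value function -/

/-- `f` satisfies the sub-optimality inequality along every segment of every branch, for times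
in `I`. -/
def ActionSubOn {N : ℕ} (L : Fin N → ℝ → ℝ) (I : Set ℝ) (f : Fin N → ℝ → ℝ → ℝ) : Prop :=
  ∀ (α : Fin N) (s t y x : ℝ), s ∈ I → t ∈ I → s < t → 0 ≤ y → 0 ≤ x →
    f α t x ≤ f α s y + (t - s) * L α ((x - y) / (t - s))

/-- `Reaches L β z α t x c`: a finite concatenation of segments leads from the point `z` of
branch `β` at time `0` to the point `x` of branch `α` at time `t`, with total action `c`. -/
inductive Reaches {N : ℕ} (L : Fin N → ℝ → ℝ) (β : Fin N) (z : ℝ) :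
    Fin N → ℝ → ℝ → ℝ → Prop
  | start : Reaches L β z β 0 z 0
  | move {α : Fin N} {s y c : ℝ} (t x : ℝ) (h : Reaches L β z α s y c) (hst : s < t)
      (hx : 0 ≤ x) : Reaches L β z α t x (c + (t - s) * L α ((x - y) / (t - s)))
  | switch {α : Fin N} {s c : ℝ} (α' : Fin N) (h : Reaches L β z α s 0 c) :
      Reaches L β z α' s 0 c

/-- Costs of the admissible paths that end at `(t, x)` on branch `α`. -/
def pathCosts {N : ℕ} (L : Fin N → ℝ → ℝ) (u₀ : Fin N → ℝ → ℝ) (α : Fin N) (t x : ℝ) : Set ℝ :=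
  {r | ∃ (β : Fin N) (z c : ℝ), 0 ≤ z ∧ Reaches L β z α t x c ∧ r = u₀ β z + c}

/-- The value function for `t > 0`, extended by `u₀ - B t` for `t ≤ 0`. -/
noncomputable def valueFn {N : ℕ} (L : Fin N → ℝ → ℝ) (u₀ : Fin N → ℝ → ℝ) (B : ℝ)
    (α : Fin N) (t x : ℝ) : ℝ :=
  if t ≤ 0 then u₀ α x - B * t else sInf (pathCosts L u₀ α t x)

theorem Reaches.nonneg {N : ℕ} {L : Fin N → ℝ → ℝ} {β : Fin N} {z : ℝ} (hz : 0 ≤ z)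
    {α : Fin N} {t x c : ℝ} (h : Reaches L β z α t x c) : 0 ≤ t ∧ 0 ≤ x := by
  induction h with
  | start => exact ⟨le_rfl, hz⟩
  | move t x _ hst hx ih => exact ⟨by linarith [ih.1], hx⟩
  | switch _ _ ih => exact ih

theorem ActionSubOn.le_of_reaches {N : ℕ} {L : Fin N → ℝ → ℝ} {T : ℝ} {f : Fin N → ℝ → ℝ → ℝ}
    (hf : ActionSubOn L (Ico 0 T) f) (hf0 : ∀ α β t, t ∈ Ico 0 T → f α t 0 = f β t 0)
    {β : Fin N} {z : ℝ} (hz : 0 ≤ z) {α : Fin N} {t x c : ℝ} (h : Reaches L β z α t x c)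
    (ht : t < T) : f α t x ≤ f β 0 z + c := by
  induction h with
  | start => simp
  | @move α s y c t x h hst hx ih =>
    have := h.nonneg hz
    have h1 := ih (hst.trans ht)
    have h2 := hf α s t y x ⟨this.1, hst.trans ht⟩ ⟨this.1.trans hst.le, ht⟩ hst this.2 hx
    linarith
  | switch α' h ih =>
    rw [hf0 α' _ _ ⟨(h.nonneg hz).1, ht⟩]
    exact ih ht

/-- Two consecutive action inequalities along one segment add up. -/
theorem action_split {l : ℝ → ℝ} {s m t y x : ℝ} (h1 : s < m) (h2 : m < t) :
    ∃ z, (z - y) / (m - s) = (x - y) / (t - s) ∧ (x - z) / (t - m) = (x - y) / (t - s) ∧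
      (0 ≤ y → 0 ≤ x → 0 ≤ z) ∧
      (m - s) * l ((z - y) / (m - s)) + (t - m) * l ((x - z) / (t - m)) =
        (t - s) * l ((x - y) / (t - s)) := by
  have a1 : m - s ≠ 0 := by linarith
  have a2 : t - m ≠ 0 := by linarith
  have a3 : 0 < t - s := by linarith
  have e1 : (y + (x - y) / (t - s) * (m - s) - y) / (m - s) = (x - y) / (t - s) := by
    field_simp; ring
  have e2 : (x - (y + (x - y) / (t - s) * (m - s))) / (t - m) = (x - y) / (t - s) := by
    field_simp; ring
  refine ⟨y + (x - y) / (t - s) * (m - s), e1, e2, ?_, ?_⟩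
  · intro hy hx
    have : y + (x - y) / (t - s) * (m - s) = (y * (t - m) + x * (m - s)) / (t - s) := by
      field_simp; ring
    rw [this]
    apply div_nonneg _ a3.le
    have := mul_nonneg hy (sub_nonneg.2 h2.le)
    have := mul_nonneg hx (sub_nonneg.2 h1.le)
    linarith
  · rw [e1, e2]; ring

section Value

variable {N : ℕ} {L : Fin N → ℝ → ℝ} {u₀ : Fin N → ℝ → ℝ} {B K : ℝ}

theorem actionSubOn_initial (hK : ∀ α x y, 0 ≤ x → 0 ≤ y → |u₀ α x - u₀ α y| ≤ K * |x - y|)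
    (hB : ∀ α q, K * |q| - B ≤ L α q) (I : Set ℝ) :
    ActionSubOn L I (fun α t x => u₀ α x - B * t) := by
  intro α s t y x _ _ hst hy hx
  have h1 := hK α x y hx hy
  have hts : 0 < t - s := by linarith
  have h2 := mul_le_mul_of_nonneg_left (hB α ((x - y) / (t - s))) hts.le
  have h3 : (t - s) * (K * |(x - y) / (t - s)| - B) = K * |x - y| - B * (t - s) := by
    rw [abs_div, abs_of_pos hts]; field_simp
  have := le_abs_self (u₀ α x - u₀ α y)
  show u₀ α x - B * t ≤ u₀ α y - B * s + _
  linarith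

theorem pathCosts_ge (h0 : ∀ α β, u₀ α 0 = u₀ β 0)
    (hK : ∀ α x y, 0 ≤ x → 0 ≤ y → |u₀ α x - u₀ α y| ≤ K * |x - y|)
    (hB : ∀ α q, K * |q| - B ≤ L α q) {α : Fin N} {t x r : ℝ}
    (hr : r ∈ pathCosts L u₀ α t x) : u₀ α x - B * t ≤ r := by
  obtain ⟨β, z, c, hz, hc, rfl⟩ := hr
  have := (actionSubOn_initial hK hB (Ico 0 (t + 1))).le_of_reaches
    (fun α β t _ => by simp [h0 α β]) hz hc (by linarith)
  simpa using this

theorem pathCosts_nonempty {α : Fin N} {t x : ℝ} (ht : 0 < t) (hx : 0 ≤ x) :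
    (pathCosts L u₀ α t x).Nonempty :=
  ⟨_, α, x, _, hx, (Reaches.start).move t x ht hx, rfl⟩

theorem valueFn_junction (h0 : ∀ α β, u₀ α 0 = u₀ β 0) (α β : Fin N) (t : ℝ) :
    valueFn L u₀ B α t 0 = valueFn L u₀ B β t 0 := by
  unfold valueFn
  split_ifs
  · rw [h0 α β]
  · congr 1
    ext r
    constructor <;> rintro ⟨γ, z, c, hz, hc, rfl⟩ <;> exact ⟨γ, z, c, hz, hc.switch _, rfl⟩

theorem valueFn_zero (α : Fin N) (x : ℝ) : valueFn L u₀ B α 0 x = u₀ α x := by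
  simp [valueFn]

theorem initial_le_valueFn (h0 : ∀ α β, u₀ α 0 = u₀ β 0)
    (hK : ∀ α x y, 0 ≤ x → 0 ≤ y → |u₀ α x - u₀ α y| ≤ K * |x - y|)
    (hB : ∀ α q, K * |q| - B ≤ L α q) (α : Fin N) (t : ℝ) {x : ℝ} (hx : 0 ≤ x) :
    u₀ α x - B * t ≤ valueFn L u₀ B α t x := by
  unfold valueFn
  split_ifs with h
  · rfl
  · exact le_csInf (pathCosts_nonempty (not_le.1 h) hx) fun r hr => pathCosts_ge h0 hK hB hr

/-- The value function dominates every family that satisfies the action inequality and starts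
below `u₀`. -/
theorem le_valueFn {T : ℝ} {f : Fin N → ℝ → ℝ → ℝ}
    (hf : ActionSubOn L (Ico 0 T) f) (hf0 : ∀ α β t, t ∈ Ico 0 T → f α t 0 = f β t 0)
    (hfi : ∀ α x, 0 ≤ x → f α 0 x ≤ u₀ α x) (α : Fin N) {t x : ℝ} (ht : t ∈ Ico 0 T)
    (hx : 0 ≤ x) : f α t x ≤ valueFn L u₀ B α t x := by
  unfold valueFn
  split_ifs with h
  · obtain rfl : t = 0 := le_antisymm h ht.1
    simpa using hfi α x hx
  · refine le_csInf (pathCosts_nonempty (not_le.1 h) hx) ?_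
    rintro r ⟨β, z, c, hz, hc, rfl⟩
    linarith [hf.le_of_reaches hf0 hz hc ht.2, hfi β z hz]

theorem actionSubOn_valueFn (h0 : ∀ α β, u₀ α 0 = u₀ β 0)
    (hK : ∀ α x y, 0 ≤ x → 0 ≤ y → |u₀ α x - u₀ α y| ≤ K * |x - y|)
    (hB : ∀ α q, K * |q| - B ≤ L α q) : ActionSubOn L univ (valueFn L u₀ B) := by
  have hneg : ∀ (α : Fin N) (s t y x : ℝ), s < t → t ≤ 0 → 0 ≤ y → 0 ≤ x →
      valueFn L u₀ B α t x ≤ valueFn L u₀ B α s y + (t - s) * L α ((x - y) / (t - s)) := by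
    intro α s t y x hst ht hy hx
    have := actionSubOn_initial hK hB univ α s t y x trivial trivial hst hy hx
    simpa [valueFn, ht, hst.le.trans ht] using this
  have hpos : ∀ (α : Fin N) (s t y x : ℝ), 0 ≤ s → s < t → 0 ≤ y → 0 ≤ x →
      valueFn L u₀ B α t x ≤ valueFn L u₀ B α s y + (t - s) * L α ((x - y) / (t - s)) := by
    intro α s t y x hs hst hy hx
    have bdd : BddBelow (pathCosts L u₀ α t x) := ⟨_, fun r hr => pathCosts_ge h0 hK hB hr⟩
    rw [valueFn, if_neg (by linarith)]
    rcases hs.eq_or_lt with rfl | hs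
    · rw [valueFn_zero]
      exact csInf_le bdd ⟨α, y, _, hy, (Reaches.start).move t x hst hx, by ring⟩
    · rw [valueFn, if_neg (by linarith), ← sub_le_iff_le_add]
      refine le_csInf (pathCosts_nonempty hs hy) ?_
      rintro r ⟨β, z, c, hz, hc, rfl⟩
      rw [sub_le_iff_le_add]
      exact csInf_le bdd ⟨β, z, _, hz, hc.move t x hst hx, by ring⟩
  intro α s t y x _ _ hst hy hx
  rcases le_or_gt t 0 with ht | ht
  · exact hneg α s t y x hst ht hy hx
  rcases le_or_gt 0 s with hs | hs
  · exact hpos α s t y x hs hst hy hx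
  · obtain ⟨z, -, -, hz, e⟩ := action_split (l := L α) (y := y) (x := x) hs ht
    have h1 := hneg α s 0 y z hs le_rfl hy (hz hy hx)
    have h2 := hpos α 0 t z x le_rfl ht (hz hy hx) hx
    linarith

theorem valueFn_sub_le (h0 : ∀ α β, u₀ α 0 = u₀ β 0)
    (hK : ∀ α x y, 0 ≤ x → 0 ≤ y → |u₀ α x - u₀ α y| ≤ K * |x - y|)
    (hB : ∀ α q, K * |q| - B ≤ L α q) (α : Fin N) (t : ℝ) {h x : ℝ} (hh : 0 ≤ h) (hx : 0 ≤ x) :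
    valueFn L u₀ B α t x - B * h ≤ valueFn L u₀ B α (t + h) x := by
  rcases le_or_gt t 0 with ht | ht
  · have := initial_le_valueFn h0 hK hB α (t + h) hx
    have e : valueFn L u₀ B α t x = u₀ α x - B * t := by simp [valueFn, ht]
    rw [e]; linarith
  · have hf : ActionSubOn L (Ico 0 (t + h + 1))
        (fun α t x => valueFn L u₀ B α (t - h) x - B * h) := by
      intro α s t y x _ _ hst hy hx
      have := actionSubOn_valueFn h0 hK hB α (s - h) (t - h) y x trivial trivial
        (by linarith) hy hx
      rw [show t - h - (s - h) = t - s by ring] at this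
      show valueFn L u₀ B α (t - h) x - B * h ≤ valueFn L u₀ B α (s - h) y - B * h + _
      linarith
    have := le_valueFn (u₀ := u₀) (B := B) hf
      (fun α β t _ => by simp only [valueFn_junction h0 α β])
      (fun α x hx => by simp [valueFn, hh]) α (t := t + h) (x := x)
      ⟨by linarith, by linarith⟩ hx
    simpa using this

end Value

/-- The optimal-control solution: it satisfies the action inequality, is Lipschitz, and dominates
every family that satisfies the action inequality and starts below `u₀`. -/
theorem exists_valueFn {N : ℕ} {L : Fin N → ℝ → ℝ} {u₀ : Fin N → ℝ → ℝ}
    (h0 : ∀ α β, u₀ α 0 = u₀ β 0) {K : ℝ}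
    (hK : ∀ α x y, 0 ≤ x → 0 ≤ y → |u₀ α x - u₀ α y| ≤ K * |x - y|)
    (hL : ∀ A : ℝ, ∃ B, ∀ α q, A * |q| - B ≤ L α q) :
    ∃ u : Fin N → ℝ → ℝ → ℝ, ActionSubOn L univ u ∧ (∀ α β t, u α t 0 = u β t 0) ∧
      (∀ α x, u α 0 x = u₀ α x) ∧
      (∃ C, 0 ≤ C ∧ ∀ α s t x y, 0 ≤ x → 0 ≤ y →
        |u α t x - u α s y| ≤ C * (|t - s| + |x - y|)) ∧
      (∀ (T : ℝ) (f : Fin N → ℝ → ℝ → ℝ), ActionSubOn L (Ico 0 T) f →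
        (∀ α β t, t ∈ Ico 0 T → f α t 0 = f β t 0) → (∀ α x, 0 ≤ x → f α 0 x ≤ u₀ α x) →
        ∀ α t x, t ∈ Ico 0 T → 0 ≤ x → f α t x ≤ u α t x) := by
  obtain ⟨B, hB⟩ := hL K
  obtain ⟨M, hM⟩ : ∃ M, ∀ α, ∀ q ∈ ({0, 1, -1} : Set ℝ), L α q ≤ M := by
    obtain ⟨M, hM⟩ := (Set.finite_range
      (fun p : Fin N × ({0, 1, -1} : Set ℝ) => L p.1 p.2)).bddAbove
    exact ⟨M, fun α q hq => hM ⟨(α, ⟨q, hq⟩), rfl⟩⟩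
  have hact := actionSubOn_valueFn h0 hK hB
  have hdown := fun α t => @valueFn_sub_le N L u₀ B K h0 hK hB α t
  have htime : ∀ α t h x, 0 ≤ h → 0 ≤ x →
      valueFn L u₀ B α (t + h) x ≤ valueFn L u₀ B α t x + M * h := by
    intro α t h x hh hx
    rcases hh.eq_or_lt with rfl | hh
    · simp
    · have := hact α t (t + h) x x trivial trivial (by linarith) hx hx
      have h2 := mul_le_mul_of_nonneg_left (hM α 0 (by simp)) hh.le
      simp only [add_sub_cancel_left, sub_self, zero_div] at this
      linarith
  have hspace : ∀ α t x y, 0 ≤ x → 0 ≤ y →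
      valueFn L u₀ B α t x ≤ valueFn L u₀ B α t y + (M + B) * |x - y| := by
    intro α t x y hx hy
    rcases eq_or_ne x y with rfl | hne
    · simp
    have hpos : 0 < |x - y| := abs_pos.2 (sub_ne_zero.2 hne)
    have h1 := hact α t (t + |x - y|) y x trivial trivial (by linarith) hy hx
    have h2 := hdown α t (h := |x - y|) (x := x) hpos.le hx
    rw [add_sub_cancel_left] at h1
    have h3 : L α ((x - y) / |x - y|) ≤ M := by
      apply hM
      rcases abs_choice (x - y) with h | h
      · rw [h, div_self (sub_ne_zero.2 hne)]; simp
      · rw [h, div_neg, div_self (sub_ne_zero.2 hne)]; simp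
    have h4 := mul_le_mul_of_nonneg_left h3 hpos.le
    linarith
  refine ⟨valueFn L u₀ B, hact, valueFn_junction h0, fun α x => valueFn_zero α x, ?_,
    fun T f h1 h2 h3 α t x ht hx => le_valueFn h1 h2 h3 α ht hx⟩
  have hordered : ∀ α s t x y, 0 ≤ x → 0 ≤ y → s ≤ t →
      |valueFn L u₀ B α t x - valueFn L u₀ B α s y| ≤ (|M| + |B|) * (|t - s| + |x - y|) := by
    intro α s t x y hx hy hst
    have h1 := htime α s (t - s) x (by linarith) hx
    have h2 := hdown α s (h := t - s) (x := x) (by linarith) hx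
    rw [add_sub_cancel] at h1 h2
    have h3 := hspace α s x y hx hy
    have h4 := hspace α s y x hy hx
    rw [abs_sub_comm y x] at h4
    have hM1 := mul_le_mul_of_nonneg_right (le_abs_self M) (sub_nonneg.2 hst)
    have hB1 := mul_le_mul_of_nonneg_right (le_abs_self B) (sub_nonneg.2 hst)
    have hM2 := mul_le_mul_of_nonneg_right (le_abs_self M) (abs_nonneg (x - y))
    have hB2 := mul_le_mul_of_nonneg_right (le_abs_self B) (abs_nonneg (x - y))
    have hM3 := mul_nonneg (abs_nonneg M) (sub_nonneg.2 hst)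
    have hB3 := mul_nonneg (abs_nonneg B) (sub_nonneg.2 hst)
    rw [abs_of_nonneg (sub_nonneg.2 hst), abs_le]
    constructor <;> linarith
  refine ⟨|M| + |B|, by positivity, fun α s t x y hx hy => ?_⟩
  rcases le_total s t with h | h
  · exact hordered α s t x y hx hy h
  · rw [abs_sub_comm, abs_sub_comm t, abs_sub_comm x]
    exact hordered α t s y x hy hx h

/-! ### The value function is a viscosity solution -/

/-- The open space-time strip of one branch. -/
def strip (T : ℝ) : Set (ℝ × ℝ) := Ioo 0 T ×ˢ Ici 0

theorem uniqueDiffOn_strip (T : ℝ) : UniqueDiffOn ℝ (strip T) :=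
  (uniqueDiffOn_Ioo 0 T).prod (uniqueDiffOn_Ici 0)

theorem hasDerivWithinAt_curve {T q t x : ℝ} {F : ℝ × ℝ → ℝ} {X : ℝ → ℝ}
    (hF : ContDiffOn ℝ 1 F (strip T)) (hz : (t, x) ∈ strip T) {A : Set ℝ}
    (hX : HasDerivWithinAt X q A t) (hXt : X t = x) (hA : ∀ σ ∈ A, (σ, X σ) ∈ strip T) :
    HasDerivWithinAt (fun σ => F (σ, X σ))
      (fderivWithin ℝ F (strip T) (t, x) (1, 0) + q * fderivWithin ℝ F (strip T) (t, x) (0, 1))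
      A t := by
  have h1 : HasFDerivWithinAt F (fderivWithin ℝ F (strip T) (t, x)) (strip T) (t, X t) := by
    rw [hXt]
    exact ((hF.differentiableOn one_ne_zero) _ hz).hasFDerivWithinAt
  have h2 : HasDerivWithinAt (fun σ => (σ, X σ)) ((1 : ℝ), q) A t :=
    (hasDerivWithinAt_id t A).prodMk hX
  have h3 := h1.comp_hasDerivWithinAt t h2 hA
  have e : ((1 : ℝ), q) = (1, 0) + q • (0, 1) := by simp
  rw [e, map_add, map_smul, smul_eq_mul] at h3
  exact h3

theorem deriv_time_eq {T t x : ℝ} {f : ℝ → ℝ → ℝ}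
    (hF : ContDiffOn ℝ 1 (fun q : ℝ × ℝ => f q.1 q.2) (strip T)) (hz : (t, x) ∈ strip T) :
    deriv (fun s => f s x) t =
      fderivWithin ℝ (fun q : ℝ × ℝ => f q.1 q.2) (strip T) (t, x) (1, 0) := by
  have h := hasDerivWithinAt_curve (q := 0) hF hz (A := Ioo 0 T)
    (hasDerivWithinAt_const t (Ioo 0 T) x) rfl fun σ hσ => ⟨hσ, hz.2⟩
  simpa using (h.hasDerivAt (isOpen_Ioo.mem_nhds hz.1)).deriv

theorem derivWithin_space_eq {T t x : ℝ} {f : ℝ → ℝ → ℝ}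
    (hF : ContDiffOn ℝ 1 (fun q : ℝ × ℝ => f q.1 q.2) (strip T)) (hz : (t, x) ∈ strip T) :
    derivWithin (fun y => f t y) (Ici 0) x =
      fderivWithin ℝ (fun q : ℝ × ℝ => f q.1 q.2) (strip T) (t, x) (0, 1) := by
  have h1 : HasFDerivWithinAt (fun q : ℝ × ℝ => f q.1 q.2)
      (fderivWithin ℝ (fun q : ℝ × ℝ => f q.1 q.2) (strip T) (t, x)) (strip T) (t, x) :=
    ((hF.differentiableOn one_ne_zero) _ hz).hasFDerivWithinAt
  have h2 : HasDerivWithinAt (fun y : ℝ => (t, y)) ((0 : ℝ), (1 : ℝ)) (Ici 0) x :=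
    (hasDerivWithinAt_const x _ t).prodMk (hasDerivWithinAt_id x _)
  exact (h1.comp_hasDerivWithinAt x h2 fun y hy => ⟨hz.1, hy⟩).derivWithin
    ((uniqueDiffOn_Ici 0) x hz.2)

theorem deriv_le_of_touch_left {g : ℝ → ℝ} {d l t a : ℝ} (hat : a < t)
    (hg : HasDerivWithinAt g d (Ioo a t) t) (h : ∀ σ ∈ Ioo a t, g t ≤ g σ + (t - σ) * l) :
    d ≤ l := by
  rw [hasDerivWithinAt_iff_tendsto_slope' (by simp)] at hg
  have : (nhdsWithin t (Ioo a t)).NeBot := right_nhdsWithin_Ioo_neBot hat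
  refine le_of_tendsto hg ?_
  filter_upwards [self_mem_nhdsWithin] with σ hσ
  rw [slope_def_field, div_le_iff_of_neg (by linarith [hσ.2])]
  linarith [h σ hσ]

theorem touch_above {N : ℕ} {L : Fin N → ℝ → ℝ} {T : ℝ} {u : Fin N → ℝ → ℝ → ℝ}
    (hu : ActionSubOn L univ u) {α : Fin N} {F : ℝ × ℝ → ℝ} (hF : ContDiffOn ℝ 1 F (strip T))
    (hle : ∀ z ∈ strip T, u α z.1 z.2 ≤ F z) {t x q : ℝ} (hz : (t, x) ∈ strip T)
    (heq : u α t x = F (t, x)) (hq : 0 < x ∨ q ≤ 0) :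
    fderivWithin ℝ F (strip T) (t, x) (1, 0) + q * fderivWithin ℝ F (strip T) (t, x) (0, 1)
      ≤ L α q := by
  obtain ⟨a, ha0, hat, ha⟩ : ∃ a, 0 < a ∧ a < t ∧ ∀ σ ∈ Ioo a t, 0 ≤ x + q * (σ - t) := by
    have ht : 0 < t := hz.1.1
    have hx : 0 ≤ x := hz.2
    rcases le_or_gt q 0 with hq' | hq'
    · refine ⟨t / 2, by linarith, by linarith, fun σ hσ => ?_⟩
      have := mul_nonneg_of_nonpos_of_nonpos hq' (sub_nonpos.2 hσ.2.le)
      linarith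
    · have hx' : 0 < x := hq.resolve_right (not_le.2 hq')
      refine ⟨max (t / 2) (t - x / q), by positivity, ?_, fun σ hσ => ?_⟩
      · exact max_lt (by linarith) (by linarith [div_pos hx' hq'])
      · have h1 : t - x / q < σ := (le_max_right _ _).trans_lt hσ.1
        have h2 := mul_lt_mul_of_pos_left h1 hq'
        rw [mul_sub, mul_div_cancel₀ _ hq'.ne'] at h2
        linarith
  have hS : ∀ σ ∈ Ioo a t, (σ, x + q * (σ - t)) ∈ strip T := fun σ hσ =>
    ⟨⟨ha0.trans hσ.1, hσ.2.trans hz.1.2⟩, ha σ hσ⟩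
  have hX : HasDerivWithinAt (fun σ => x + q * (σ - t)) q (Ioo a t) t := by
    have := (((hasDerivAt_id t).sub_const t).const_mul q).const_add x
    simpa using this.hasDerivWithinAt (s := Ioo a t)
  refine deriv_le_of_touch_left hat (hasDerivWithinAt_curve hF hz hX (by simp) hS) ?_
  intro σ hσ
  have h1 := hu α σ t (x + q * (σ - t)) x trivial trivial hσ.2 (ha σ hσ) hz.2
  have h2 := hle _ (hS σ hσ)
  have h3 : (x - (x + q * (σ - t))) / (t - σ) = q := by
    have : t - σ ≠ 0 := by linarith [hσ.2]
    field_simp; ring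
  rw [h3] at h1
  simp only [sub_self, mul_zero, add_zero]
  simp only at h2
  linarith

section Lipschitz

variable {N : ℕ} {u : Fin N → ℝ → ℝ → ℝ} {C : ℝ}

theorem lipschitzOnWith_of_abs (hC : 0 ≤ C)
    (hu : ∀ α s t x y, 0 ≤ x → 0 ≤ y → |u α t x - u α s y| ≤ C * (|t - s| + |x - y|))
    (α : Fin N) :
    LipschitzOnWith (Real.toNNReal (2 * C)) (fun q : ℝ × ℝ => u α q.1 q.2) (univ ×ˢ Ici 0) := by
  refine LipschitzOnWith.of_dist_le_mul ?_
  rintro ⟨t, x⟩ ⟨-, hx⟩ ⟨s, y⟩ ⟨-, hy⟩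
  rw [Real.dist_eq, Prod.dist_eq, Real.dist_eq, Real.dist_eq, Real.coe_toNNReal _ (by positivity)]
  refine (hu α s t x y hx hy).trans ?_
  have h1 := mul_le_mul_of_nonneg_left (le_max_left |t - s| |x - y|) hC
  have h2 := mul_le_mul_of_nonneg_left (le_max_right |t - s| |x - y|) hC
  simp only
  linarith

theorem continuousOn_of_abs (hC : 0 ≤ C)
    (hu : ∀ α s t x y, 0 ≤ x → 0 ≤ y → |u α t x - u α s y| ≤ C * (|t - s| + |x - y|))
    (α : Fin N) : ContinuousOn (fun q : ℝ × ℝ => u α q.1 q.2) (univ ×ˢ Ici 0) :=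
  (lipschitzOnWith_of_abs hC hu α).continuousOn

end Lipschitz

/-- A strict local subsolution cannot touch the value function from below. -/
theorem no_strict_touch_below {N : ℕ} {L : Fin N → ℝ → ℝ} {T : ℝ} {u : Fin N → ℝ → ℝ → ℝ}
    (hu : ActionSubOn L univ u) (hu0 : ∀ α β t, u α t 0 = u β t 0)
    (huc : ∀ α, ContinuousOn (fun q : ℝ × ℝ => u α q.1 q.2) (univ ×ˢ Ici 0))
    (hmax : ∀ f : Fin N → ℝ → ℝ → ℝ, ActionSubOn L (Ico 0 T) f →
        (∀ α β t, t ∈ Ico 0 T → f α t 0 = f β t 0) → (∀ α x, 0 ≤ x → f α 0 x ≤ u α 0 x) →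
        ∀ α t x, t ∈ Ico 0 T → 0 ≤ x → f α t x ≤ u α t x)
    {t₀ x₀ : ℝ} (hz : (t₀, x₀) ∈ strip T) (A : Set (Fin N)) (F : Fin N → ℝ × ℝ → ℝ)
    (hF : ∀ β ∈ A, ContDiffOn ℝ 1 (F β) (strip T))
    (hle : ∀ β ∈ A, ∀ z ∈ strip T, F β z ≤ u β z.1 z.2 - ((z.1 - t₀) ^ 2 + (z.2 - x₀) ^ 2))
    (hG : ∀ β ∈ A, ∀ᶠ z in nhdsWithin (t₀, x₀) (strip T), ∀ q,
      fderivWithin ℝ (F β) (strip T) z (1, 0) + q * fderivWithin ℝ (F β) (strip T) z (0, 1)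
        ≤ L β q)
    (hA : 0 < x₀ ∨ (A = univ ∧ ∀ α β t, F α (t, 0) = F β (t, 0)))
    {α : Fin N} (hα : α ∈ A) : F α (t₀, x₀) < u α t₀ x₀ := by
  classical
  have ht₀ : 0 < t₀ := hz.1.1
  obtain ⟨r, hr0, hrt, hrx, hr⟩ : ∃ r, 0 < r ∧ r < t₀ ∧ (0 < x₀ → r < x₀) ∧
      ∀ β ∈ A, ∀ z ∈ strip T, |z.1 - t₀| < r → |z.2 - x₀| < r → ∀ q,
        fderivWithin ℝ (F β) (strip T) z (1, 0) + q * fderivWithin ℝ (F β) (strip T) z (0, 1)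
        ≤ L β q := by
    have hall : ∀ᶠ z in nhdsWithin (t₀, x₀) (strip T), ∀ β, β ∈ A → ∀ q,
        fderivWithin ℝ (F β) (strip T) z (1, 0) + q * fderivWithin ℝ (F β) (strip T) z (0, 1)
        ≤ L β q := by
      rw [eventually_all]
      intro β
      by_cases hβ : β ∈ A
      · filter_upwards [hG β hβ] with z hz _ using hz
      · exact Eventually.of_forall fun z h => absurd h hβ
    obtain ⟨ε, hε, h⟩ := Metric.mem_nhdsWithin_iff.1 hall
    have key : ∀ r, r ≤ ε → ∀ β ∈ A, ∀ z ∈ strip T, |z.1 - t₀| < r → |z.2 - x₀| < r → ∀ q,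
        fderivWithin ℝ (F β) (strip T) z (1, 0) + q * fderivWithin ℝ (F β) (strip T) z (0, 1)
        ≤ L β q := fun r hrε β hβ z hzS h1 h2 => by
      refine h ⟨?_, hzS⟩ β hβ
      rw [Metric.mem_ball, Prod.dist_eq, Real.dist_eq, Real.dist_eq]
      exact max_lt (h1.trans_le hrε) (h2.trans_le hrε)
    by_cases hx : 0 < x₀
    · refine ⟨min ε (min (t₀ / 2) (x₀ / 2)), by positivity, ?_, fun _ => ?_,
        key _ (min_le_left _ _)⟩
      · exact (min_le_right _ _).trans_lt ((min_le_left _ _).trans_lt (by linarith))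
      · exact (min_le_right _ _).trans_lt ((min_le_right _ _).trans_lt (by linarith))
    · refine ⟨min ε (t₀ / 2), by positivity, ?_, fun h => absurd h hx, key _ (min_le_left _ _)⟩
      exact (min_le_right _ _).trans_lt (by linarith)
  set κ := r ^ 2 / 2 with hκ
  have hκ0 : 0 < κ := by positivity
  set a := t₀ - r with ha
  have ha0 : 0 < a := by linarith
  set w : Fin N → ℝ → ℝ → ℝ := fun β t x =>
    if a < t ∧ β ∈ A then max (u β t x) (F β (t, x) + κ) else u β t x with hw
  have huw : ∀ β t x, u β t x ≤ w β t x := by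
    intro β t x
    simp only [hw]
    split_ifs
    · exact le_max_left _ _
    · exact le_rfl
  have hnear : ∀ β ∈ A, ∀ z ∈ strip T, u β z.1 z.2 < F β z + κ →
      |z.1 - t₀| < r ∧ |z.2 - x₀| < r := by
    intro β hβ z hzS hlt
    have h1 := hle β hβ z hzS
    have h2 := sq_nonneg (z.1 - t₀)
    have h3 := sq_nonneg (z.2 - x₀)
    have h4 : 0 < r ^ 2 := by positivity
    constructor <;> refine abs_lt_of_sq_lt_sq ?_ hr0.le <;> linarith
  have hact : ActionSubOn L (Ico 0 T) w := by
    intro β s t y x hs ht hst hy hx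
    have hub := hu β s t y x trivial trivial hst hy hx
    have hus : u β t x ≤ w β s y + (t - s) * L β ((x - y) / (t - s)) := by
      linarith [huw β s y]
    by_cases hcase : a < t ∧ β ∈ A
    swap
    · have : w β t x = u β t x := by simp only [hw, if_neg hcase]
      rw [this]; exact hus
    obtain ⟨hat, hβ⟩ := hcase
    have : w β t x = max (u β t x) (F β (t, x) + κ) := by simp only [hw, if_pos (And.intro hat hβ)]
    rw [this]
    refine max_le hus ?_
    by_cases hFu : F β (t, x) + κ ≤ u β t x
    · exact hFu.trans hus
    rw [not_le] at hFu
    set q := (x - y) / (t - s) with hq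
    have hts : 0 < t - s := by linarith
    set X : ℝ → ℝ := fun σ => x + q * (σ - t) with hX
    have hXt : X t = x := by simp [hX]
    have hXs : X s = y := by
      have : q * (t - s) = x - y := by rw [hq]; field_simp
      simp only [hX]; linarith
    have hX0 : ∀ σ ∈ Icc s t, 0 ≤ X σ := by
      intro σ hσ
      have e : X σ = (x * (σ - s) + y * (t - σ)) / (t - s) := by
        simp only [hX, hq]; field_simp; ring
      rw [e]
      have h1 := mul_nonneg hx (sub_nonneg.2 hσ.1)
      have h2 := mul_nonneg hy (sub_nonneg.2 hσ.2)
      positivity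
    have hXc : Continuous X := by fun_prop
    set b := max s a with hb
    have hbt : b < t := max_lt hst hat
    have hbS : ∀ σ ∈ Icc b t, (σ, X σ) ∈ strip T := fun σ hσ =>
      ⟨⟨ha0.trans_le ((le_max_right _ _).trans hσ.1), hσ.2.trans_lt ht.2⟩,
        hX0 σ ⟨(le_max_left _ _).trans hσ.1, hσ.2⟩⟩
    set g : ℝ → ℝ := fun σ => F β (σ, X σ) + κ with hg
    set U : ℝ → ℝ := fun σ => u β σ (X σ) with hU
    have hgc : ContinuousOn g (Icc b t) := by
      refine ContinuousOn.add ?_ continuousOn_const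
      exact (hF β hβ).continuousOn.comp (by fun_prop) hbS
    have hUc : ContinuousOn U (Icc b t) :=
      (huc β).comp (f := fun σ => (σ, X σ)) (by fun_prop) fun σ hσ => ⟨trivial, (hbS σ hσ).2⟩
    obtain ⟨m, hm, hmono, hmend⟩ : ∃ m ∈ Ico b t, (∀ σ ∈ Ioo m t, U σ < g σ) ∧
        ((m = s ∧ a < s) ∨ g m ≤ U m) := by
      by_cases hE : ∃ σ ∈ Icc b t, g σ ≤ U σ
      · have hcl : IsCompact {σ ∈ Icc b t | g σ ≤ U σ} :=
          (isCompact_Icc.isClosed.isClosed_le hgc hUc) |> isCompact_Icc.of_isClosed_subset <|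
            fun σ hσ => hσ.1
        obtain ⟨m, hm, hmax'⟩ := hcl.exists_isGreatest hE
        refine ⟨m, ⟨hm.1.1, hm.1.2.lt_of_ne ?_⟩, fun σ hσ => ?_, Or.inr hm.2⟩
        · rintro rfl
          have := hm.2
          simp only [hg, hU, hXt] at this
          linarith
        · by_contra hcon
          have := hmax' ⟨⟨hm.1.1.trans hσ.1.le, hσ.2.le⟩, not_lt.1 hcon⟩
          linarith [hσ.1]
      · push Not at hE
        have has : a < s := by
          by_contra hcon
          have hba : b = a := max_eq_right (not_lt.1 hcon)
          have h1 := hE b ⟨le_rfl, hbt.le⟩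
          have h2 := (hnear β hβ _ (hbS b ⟨le_rfl, hbt.le⟩) h1).1
          simp only [hba, ha] at h2
          rw [show t₀ - r - t₀ = -r by ring, abs_neg, abs_of_pos hr0] at h2
          exact lt_irrefl _ h2
        have hbs : b = s := max_eq_left has.le
        exact ⟨s, ⟨hbs.le, hst⟩, fun σ hσ => hE σ ⟨hbs.le.trans hσ.1.le, hσ.2.le⟩,
          Or.inl ⟨rfl, has⟩⟩
    have hsub : Icc m t ⊆ Icc b t := Icc_subset_Icc_left hm.1
    have hd : ∀ σ ∈ Ioo m t, HasDerivAt g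
        (fderivWithin ℝ (F β) (strip T) (σ, X σ) (1, 0) +
          q * fderivWithin ℝ (F β) (strip T) (σ, X σ) (0, 1)) σ := by
      intro σ hσ
      have hXd : HasDerivWithinAt X q (Ioo m t) σ :=
        ((((hasDerivAt_id σ).sub_const t).const_mul q).const_add x).hasDerivWithinAt.congr_deriv
          (mul_one q)
      have := hasDerivWithinAt_curve (hF β hβ) (hbS σ (hsub (Ioo_subset_Icc_self hσ))) hXd rfl
        fun τ hτ => hbS τ (hsub (Ioo_subset_Icc_self hτ))
      exact (this.hasDerivAt (isOpen_Ioo.mem_nhds hσ)).add_const κ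
    have hanti : AntitoneOn (fun σ => g σ - σ * L β q) (Icc m t) := by
      have hd' : ∀ σ ∈ Ioo m t, HasDerivAt (fun σ => g σ - σ * L β q) _ σ := fun σ hσ =>
        (hd σ hσ).sub ((hasDerivAt_id σ).mul_const (L β q))
      refine antitoneOn_of_deriv_nonpos (convex_Icc _ _)
        ((hgc.mono hsub).sub (by fun_prop)) ?_ ?_
      · rw [interior_Icc]
        exact fun σ hσ => (hd' σ hσ).differentiableAt.differentiableWithinAt
      · rw [interior_Icc]
        intro σ hσ
        rw [(hd' σ hσ).deriv]
        have hσS := hbS σ (hsub (Ioo_subset_Icc_self hσ))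
        have hn := hnear β hβ _ hσS (hmono σ hσ)
        have := hr β hβ _ hσS hn.1 hn.2 q
        linarith
    have hfin := hanti ⟨le_rfl, hm.2.le⟩ ⟨hm.2.le, le_rfl⟩ hm.2.le
    simp only at hfin
    have hgt : g t = F β (t, x) + κ := by simp only [hg, hXt]
    have hgm : g m ≤ w β s y + (m - s) * L β q := by
      rcases hmend with ⟨rfl, has⟩ | hmU
      · have : w β m y = max (u β m y) (F β (m, y) + κ) := by
          simp only [hw, if_pos (And.intro has hβ)]
        rw [this]
        simp only [hg, hXs, sub_self, zero_mul, add_zero]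
        exact le_max_right _ _
      · have hsm : s ≤ m := (le_max_left _ _).trans hm.1
        rcases hsm.eq_or_lt with rfl | hsm
        · have := huw β s y
          simp only [hU, hXs] at hmU
          linarith
        · have h1 := hu β s m y (X m) trivial trivial hsm hy (hX0 m ⟨hsm.le, hm.2.le⟩)
          have h2 : (X m - y) / (m - s) = q := by
            have : m - s ≠ 0 := by linarith
            rw [← hXs]; simp only [hX]; field_simp; ring
          rw [h2] at h1
          have := huw β s y
          simp only [hU] at hmU
          linarith
    linarith
  have hfin := hmax w hact ?_ ?_ α t₀ x₀ ⟨hz.1.1.le, hz.1.2⟩ hz.2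
  · have : w α t₀ x₀ = max (u α t₀ x₀) (F α (t₀, x₀) + κ) := by
      simp only [hw, if_pos (And.intro (show a < t₀ by linarith) hα)]
    rw [this] at hfin
    linarith [(le_max_right _ _).trans hfin]
  · intro β γ t ht
    by_cases hat : a < t
    swap
    · simp only [hw, hat, false_and, if_false]; exact hu0 β γ t
    rcases hA with hx | ⟨rfl, hc⟩
    · have hzero : ∀ β, w β t 0 = u β t 0 := by
        intro β
        simp only [hw]
        split_ifs with h
        · refine max_eq_left (not_lt.1 fun hlt => ?_)
          have h0 : ((t, 0) : ℝ × ℝ) ∈ strip T := ⟨⟨ha0.trans hat, ht.2⟩, le_refl (0 : ℝ)⟩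
          have := (hnear β h.2 _ h0 hlt).2
          simp only [zero_sub, abs_neg, abs_of_pos hx] at this
          linarith [hrx hx]
        · rfl
      rw [hzero, hzero, hu0 β γ t]
    · simp only [hw, mem_univ, and_true, hat, if_true, hu0 β γ t, hc β γ t]
  · intro β x _
    simp only [hw, not_lt.2 ha0.le, false_and, if_false]
    exact le_rfl

/-- The Hamiltonians are the Legendre transforms, full and restricted to `q ≤ 0`, of `L`. -/
structure IsTransform {N : ℕ} (L : Fin N → ℝ → ℝ) (H : Fin N → ℝ → ℝ) (p₀ : Fin N → ℝ) :
    Prop where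
  le_full : ∀ α p q, p * q - L α q ≤ H α p
  full_le : ∀ α p c, (∀ q, p * q - L α q ≤ c) → H α p ≤ c
  minus_le : ∀ α p c, (∀ q ≤ 0, p * q - L α q ≤ c) → Hm (H α) (p₀ α) p ≤ c

theorem Hm_eq_min (H : ℝ → ℝ) (p₀ p : ℝ) : Hm H p₀ p = H (min p p₀) := by
  unfold Hm
  split_ifs with h
  · rw [min_eq_left h]
  · rw [min_eq_right (not_le.1 h).le]

section Viscosity

variable {N : ℕ} {L H : Fin N → ℝ → ℝ} {p₀ : Fin N → ℝ} {T : ℝ} {u : Fin N → ℝ → ℝ → ℝ}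

theorem value_isViscSubSol (hN : 1 ≤ N) (hH : IsTransform L H p₀) (hu : ActionSubOn L univ u)
    (hu0 : ∀ α β t, u α t 0 = u β t 0)
    (huc : ∀ α, ContinuousOn (fun q : ℝ × ℝ => u α q.1 q.2) (univ ×ˢ Ici 0)) :
    IsViscSubSol T H p₀ u := by
  have : Nonempty (Fin N) := ⟨⟨0, hN⟩⟩
  refine ⟨fun α => ((huc α).mono (prod_mono_left (subset_univ _))).upperSemicontinuousOn, hu0,
    fun φ hφ hφ0 hle => ⟨fun α t x ht hx heq => ?_, fun t ht heq α => ?_⟩⟩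
  · have hz : (t, x) ∈ strip T := ⟨ht, hx.le⟩
    rw [deriv_time_eq (hφ α) hz, derivWithin_space_eq (hφ α) hz, ← le_neg_iff_add_nonpos_left]
    refine hH.full_le _ _ _ fun q => ?_
    have := touch_above hu (hφ α) (fun z hz => hle α z.1 z.2 hz.1 hz.2) hz heq (q := q)
      (Or.inl hx)
    linarith
  · have hz : (t, (0 : ℝ)) ∈ strip T := ⟨ht, le_refl (0 : ℝ)⟩
    rw [← le_neg_iff_add_nonpos_left]
    refine csSup_le (range_nonempty _) ?_
    rintro _ ⟨β, rfl⟩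
    simp only
    have e : (fun s => φ α s 0) = fun s => φ β s 0 := funext fun s => hφ0 α β s
    rw [e, deriv_time_eq (hφ β) hz, derivWithin_space_eq (hφ β) hz]
    refine hH.minus_le _ _ _ fun q hq => ?_
    have := touch_above hu (hφ β) (fun z hz => hle β z.1 z.2 hz.1 hz.2) hz (heq β) (q := q)
      (Or.inr hq)
    linarith

/-- Subtracting a quadratic and a linear function of `x` from a test function. -/
theorem fderivWithin_sub_quad {f : ℝ → ℝ → ℝ} (c t₀ x₀ : ℝ)
    (hf : ContDiffOn ℝ 1 (fun q : ℝ × ℝ => f q.1 q.2) (strip T)) (hz : (t₀, x₀) ∈ strip T) :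
    ContDiffOn ℝ 1 (fun q : ℝ × ℝ => f q.1 q.2 - c * q.2 - ((q.1 - t₀) ^ 2 + (q.2 - x₀) ^ 2))
      (strip T) ∧
    fderivWithin ℝ (fun q : ℝ × ℝ => f q.1 q.2 - c * q.2 - ((q.1 - t₀) ^ 2 + (q.2 - x₀) ^ 2))
      (strip T) (t₀, x₀) (1, 0) = deriv (fun s => f s x₀) t₀ ∧
    fderivWithin ℝ (fun q : ℝ × ℝ => f q.1 q.2 - c * q.2 - ((q.1 - t₀) ^ 2 + (q.2 - x₀) ^ 2))
      (strip T) (t₀, x₀) (0, 1) = derivWithin (fun y => f t₀ y) (Ici 0) x₀ - c := by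
  have h1 : ContDiffOn ℝ 1
      (fun q : ℝ × ℝ => f q.1 q.2 - c * q.2 - ((q.1 - t₀) ^ 2 + (q.2 - x₀) ^ 2)) (strip T) := by
    refine (hf.sub ?_).sub ?_ <;> exact ContDiff.contDiffOn (by fun_prop)
  have hd : HasFDerivWithinAt (fun q : ℝ × ℝ => f q.1 q.2)
      (fderivWithin ℝ (fun q : ℝ × ℝ => f q.1 q.2) (strip T) (t₀, x₀)) (strip T) (t₀, x₀) :=
    ((hf.differentiableOn one_ne_zero) _ hz).hasFDerivWithinAt
  have hfst : HasFDerivWithinAt (fun q : ℝ × ℝ => q.1) (ContinuousLinearMap.fst ℝ ℝ ℝ)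
      (strip T) (t₀, x₀) := hasFDerivWithinAt_fst
  have hsnd : HasFDerivWithinAt (fun q : ℝ × ℝ => q.2) (ContinuousLinearMap.snd ℝ ℝ ℝ)
      (strip T) (t₀, x₀) := hasFDerivWithinAt_snd
  have h2 := ((hd.sub (hsnd.const_mul c)).sub
    (((hfst.sub_const t₀).pow 2).add ((hsnd.sub_const x₀).pow 2))).fderivWithin
      (uniqueDiffOn_strip T _ hz)
  refine ⟨h1, ?_, ?_⟩
  · rw [deriv_time_eq hf hz]
    refine (DFunLike.congr_fun h2 ((1 : ℝ), (0 : ℝ))).trans ?_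
    simp
  · rw [derivWithin_space_eq hf hz]
    refine (DFunLike.congr_fun h2 ((0 : ℝ), (1 : ℝ))).trans ?_
    simp

theorem eventually_strict_sub (hH : IsTransform L H p₀) (hHc : ∀ α, Continuous (H α)) {α : Fin N}
    {F : ℝ × ℝ → ℝ} (hF : ContDiffOn ℝ 1 F (strip T)) {z : ℝ × ℝ} (hz : z ∈ strip T)
    (h : fderivWithin ℝ F (strip T) z (1, 0) + H α (fderivWithin ℝ F (strip T) z (0, 1)) < 0) :
    ∀ᶠ y in nhdsWithin z (strip T), ∀ q,
      fderivWithin ℝ F (strip T) y (1, 0) + q * fderivWithin ℝ F (strip T) y (0, 1) ≤ L α q := by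
  have hD := hF.continuousOn_fderivWithin (uniqueDiffOn_strip T) le_rfl
  have hc : ContinuousOn (fun y => fderivWithin ℝ F (strip T) y (1, 0) +
      H α (fderivWithin ℝ F (strip T) y (0, 1))) (strip T) :=
    (hD.clm_apply continuousOn_const).add
      ((hHc α).comp_continuousOn (hD.clm_apply continuousOn_const))
  filter_upwards [(hc z hz).eventually (gt_mem_nhds h)] with y hy q
  have := hH.le_full α (fderivWithin ℝ F (strip T) y (0, 1)) q
  linarith

theorem value_isViscSuperSol (hH : IsTransform L H p₀)
    (hHc : ∀ α, Continuous (H α)) (hu : ActionSubOn L univ u)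
    (hu0 : ∀ α β t, u α t 0 = u β t 0)
    (huc : ∀ α, ContinuousOn (fun q : ℝ × ℝ => u α q.1 q.2) (univ ×ˢ Ici 0))
    (hmax : ∀ f : Fin N → ℝ → ℝ → ℝ, ActionSubOn L (Ico 0 T) f →
        (∀ α β t, t ∈ Ico 0 T → f α t 0 = f β t 0) → (∀ α x, 0 ≤ x → f α 0 x ≤ u α 0 x) →
        ∀ α t x, t ∈ Ico 0 T → 0 ≤ x → f α t x ≤ u α t x) :
    IsViscSuperSol T H p₀ u := by
  refine ⟨fun α => ((huc α).mono (prod_mono_left (subset_univ _))).lowerSemicontinuousOn, hu0,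
    fun φ hφ hφ0 hle => ⟨fun α t x ht hx heq => ?_, fun t ht heq α => ?_⟩⟩
  · by_contra! hneg
    have hz : (t, x) ∈ strip T := ⟨ht, hx.le⟩
    obtain ⟨h1, h2, h3⟩ := fderivWithin_sub_quad 0 t x (hφ α) hz
    have := no_strict_touch_below hu hu0 huc hmax hz {α}
      (fun _ q => φ α q.1 q.2 - 0 * q.2 - ((q.1 - t) ^ 2 + (q.2 - x) ^ 2)) (fun _ _ => h1)
      ?_ ?_ (Or.inl hx) (mem_singleton α)
    · simp only at this
      rw [heq] at this
      linarith
    · rintro β rfl z hz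
      have := hle β z.1 z.2 hz.1 hz.2
      linarith
    · rintro β rfl
      refine eventually_strict_sub hH hHc h1 hz ?_
      rw [h2, h3, sub_zero]
      exact hneg
  · by_contra! hneg
    have hz : (t, (0 : ℝ)) ∈ strip T := ⟨ht, le_refl (0 : ℝ)⟩
    set c : Fin N → ℝ := fun β => derivWithin (fun y => φ β t y) (Ici 0) 0 -
      min (derivWithin (fun y => φ β t y) (Ici 0) 0) (p₀ β) with hc
    have hc0 : ∀ β, 0 ≤ c β := fun β => sub_nonneg.2 (min_le_left _ _)
    have := no_strict_touch_below hu hu0 huc hmax hz univ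
      (fun β q => φ β q.1 q.2 - c β * q.2 - ((q.1 - t) ^ 2 + (q.2 - 0) ^ 2))
      (fun β _ => (fderivWithin_sub_quad (c β) t 0 (hφ β) hz).1)
      ?_ ?_ (Or.inr ⟨rfl, fun β γ s => by simp [hφ0 β γ s]⟩) (mem_univ α)
    · simp only at this
      rw [heq α] at this
      linarith
    · intro β _ z hz
      have h1 := hle β z.1 z.2 hz.1 hz.2
      have h2 := mul_nonneg (hc0 β) hz.2
      linarith
    · intro β _
      obtain ⟨h1, h2, h3⟩ := fderivWithin_sub_quad (c β) t 0 (hφ β) hz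
      refine eventually_strict_sub hH hHc h1 hz ?_
      rw [h2, h3]
      have e : (fun s => φ β s 0) = fun s => φ α s 0 := funext fun s => hφ0 β α s
      have h4 : Hm (H β) (p₀ β) (derivWithin (fun y => φ β t y) (Ici 0) 0) ≤
          sSup (Set.range fun β : Fin N =>
            Hm (H β) (p₀ β) (derivWithin (fun y => φ β t y) (Ici 0) 0)) :=
        le_csSup (Set.finite_range _).bddAbove ⟨β, rfl⟩
      rw [Hm_eq_min] at h4
      rw [e, hc, sub_sub_cancel]
      linarith

end Viscosity

/-! ### Local test functions -/

/-- Gluing a local test function to a global affine bound. -/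
theorem le_glue {χ a b c : ℝ} (h0 : 0 ≤ χ) (h1 : χ ≤ 1) (hb : a ≤ b) (hc : χ ≠ 0 → a ≤ c) :
    a ≤ χ * c + (1 - χ) * b := by
  rcases h0.eq_or_lt with rfl | hpos
  · simpa using hb
  · nlinarith [mul_le_mul_of_nonneg_left (hc hpos.ne') h0,
      mul_le_mul_of_nonneg_left hb (sub_nonneg.2 h1)]

section Tests

variable {N : ℕ} {T A K : ℝ} {v : Fin N → ℝ → ℝ → ℝ}

theorem exists_test_above_interior
    (hgr : ∀ β t x, t ∈ Ioo 0 T → 0 ≤ x → v β t x ≤ A + K * x)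
    {α : Fin N} {t₀ x₀ : ℝ} (hx₀ : 0 < x₀) {φ : ℝ × ℝ → ℝ} (hφ : ContDiff ℝ 1 φ)
    (hle : ∀ᶠ z in nhds (t₀, x₀), v α z.1 z.2 ≤ φ z) :
    ∃ Φ : Fin N → ℝ → ℝ → ℝ, (∀ β, ContDiff ℝ 1 (fun q : ℝ × ℝ => Φ β q.1 q.2)) ∧
      (∀ β γ t, Φ β t 0 = Φ γ t 0) ∧ (∀ β t x, t ∈ Ioo 0 T → 0 ≤ x → v β t x ≤ Φ β t x) ∧
      (fun q : ℝ × ℝ => Φ α q.1 q.2) =ᶠ[nhds (t₀, x₀)] φ := by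
  obtain ⟨ε, hε, hball⟩ := Metric.eventually_nhds_iff_ball.1 hle
  have hr : 0 < min ε x₀ := lt_min hε hx₀
  let χ : ContDiffBump ((t₀, x₀) : ℝ × ℝ) := ⟨min ε x₀ / 2, min ε x₀, by positivity, by linarith⟩
  have hχ : ∀ z, χ z ≠ 0 → dist z (t₀, x₀) < min ε x₀ := fun z hz =>
    not_le.1 fun h => hz (χ.zero_of_le_dist h)
  have hχ0 : ∀ t, χ (t, 0) = 0 := by
    intro t
    by_contra h
    have := (hχ _ h).trans_le (min_le_right _ _)
    rw [Prod.dist_eq] at this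
    have := (le_max_right _ _).trans_lt this
    simp only [Real.dist_eq, zero_sub, abs_neg, abs_of_pos hx₀] at this
    exact lt_irrefl _ this
  refine ⟨fun β t x => if β = α then χ (t, x) * φ (t, x) + (1 - χ (t, x)) * (A + K * x)
    else A + K * x, fun β => ?_, fun β γ t => ?_, fun β t x ht hx => ?_, ?_⟩
  · have hc : ContDiff ℝ 1 χ := χ.contDiff
    by_cases h : β = α
    · simp only [h, if_true]
      fun_prop
    · simp only [h, if_false]
      fun_prop
  · simp [hχ0]
  · simp only
    split_ifs with h
    · subst h
      exact le_glue χ.nonneg χ.le_one (hgr _ _ _ ht hx) fun hne =>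
        hball (t, x) ((hχ _ hne).trans_le (min_le_left _ _))
    · exact hgr _ _ _ ht hx
  · filter_upwards [χ.eventuallyEq_one] with z hz
    simp only [if_true, Prod.mk.eta, hz, Pi.one_apply]
    ring

theorem exists_test_above_junction
    (hgr : ∀ β t x, t ∈ Ioo 0 T → 0 ≤ x → v β t x ≤ A + K * x)
    {t₀ : ℝ} {φ : Fin N → ℝ × ℝ → ℝ} (hφ : ∀ β, ContDiff ℝ 1 (φ β))
    (hφ0 : ∀ β γ t, φ β (t, 0) = φ γ (t, 0))
    (hle : ∀ β, ∀ᶠ z in nhdsWithin (t₀, 0) (univ ×ˢ Ici 0), v β z.1 z.2 ≤ φ β z) :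
    ∃ Φ : Fin N → ℝ → ℝ → ℝ, (∀ β, ContDiff ℝ 1 (fun q : ℝ × ℝ => Φ β q.1 q.2)) ∧
      (∀ β γ t, Φ β t 0 = Φ γ t 0) ∧ (∀ β t x, t ∈ Ioo 0 T → 0 ≤ x → v β t x ≤ Φ β t x) ∧
      ∀ β, (fun q : ℝ × ℝ => Φ β q.1 q.2) =ᶠ[nhds (t₀, 0)] φ β := by
  obtain ⟨ε, hε, hball⟩ := Metric.mem_nhdsWithin_iff.1 (eventually_all.2 hle)
  let χ : ContDiffBump ((t₀, 0) : ℝ × ℝ) := ⟨ε / 2, ε, by positivity, by linarith⟩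
  have hχ : ∀ z, χ z ≠ 0 → dist z (t₀, 0) < ε := fun z hz =>
    not_le.1 fun h => hz (χ.zero_of_le_dist h)
  refine ⟨fun β t x => χ (t, x) * φ β (t, x) + (1 - χ (t, x)) * (A + K * x),
    fun β => ?_, fun β γ t => ?_, fun β t x ht hx => ?_, fun β => ?_⟩
  · have hc : ContDiff ℝ 1 χ := χ.contDiff
    have := hφ β
    fun_prop
  · simp only [hφ0 β γ t]
  · exact le_glue χ.nonneg χ.le_one (hgr _ _ _ ht hx) fun hne =>
      hball ⟨hχ _ hne, trivial, hx⟩ β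
  · filter_upwards [χ.eventuallyEq_one] with z hz
    simp only [Prod.mk.eta, hz, Pi.one_apply]
    ring

theorem hasDerivAt_slices_of_eventuallyEq {Φ : ℝ → ℝ → ℝ} {φ : ℝ × ℝ → ℝ} {t₀ x₀ a p : ℝ}
    (h : (fun q : ℝ × ℝ => Φ q.1 q.2) =ᶠ[nhds (t₀, x₀)] φ)
    (ha : HasDerivAt (fun s => φ (s, x₀)) a t₀) (hp : HasDerivAt (fun y => φ (t₀, y)) p x₀) :
    HasDerivAt (fun s => Φ s x₀) a t₀ ∧ HasDerivAt (fun y => Φ t₀ y) p x₀ := by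
  constructor
  · refine ha.congr_of_eventuallyEq ?_
    have : Tendsto (fun s : ℝ => (s, x₀)) (nhds t₀) (nhds (t₀, x₀)) :=
      (by fun_prop : Continuous fun s : ℝ => (s, x₀)).tendsto t₀
    exact this.eventually h
  · refine hp.congr_of_eventuallyEq ?_
    have : Tendsto (fun y : ℝ => (t₀, y)) (nhds x₀) (nhds (t₀, x₀)) :=
      (by fun_prop : Continuous fun y : ℝ => (t₀, y)).tendsto x₀
    exact this.eventually h

variable {H : Fin N → ℝ → ℝ} {p₀ : Fin N → ℝ}

theorem IsViscSubSol.interior (hv : IsViscSubSol T H p₀ v)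
    (hgr : ∀ β t x, t ∈ Ioo 0 T → 0 ≤ x → v β t x ≤ A + K * x)
    {α : Fin N} {t₀ x₀ a p : ℝ} (ht₀ : t₀ ∈ Ioo 0 T) (hx₀ : 0 < x₀) {φ : ℝ × ℝ → ℝ}
    (hφ : ContDiff ℝ 1 φ) (ha : HasDerivAt (fun s => φ (s, x₀)) a t₀)
    (hp : HasDerivAt (fun y => φ (t₀, y)) p x₀)
    (hle : ∀ᶠ z in nhds (t₀, x₀), v α z.1 z.2 ≤ φ z) (heq : v α t₀ x₀ = φ (t₀, x₀)) :
    a + H α p ≤ 0 := by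
  obtain ⟨Φ, h1, h2, h3, h4⟩ := exists_test_above_interior hgr hx₀ hφ hle
  obtain ⟨h5, h6⟩ := hasDerivAt_slices_of_eventuallyEq h4 ha hp
  have := (hv.2.2 Φ (fun β => (h1 β).contDiffOn) h2 h3).1 α t₀ x₀ ht₀ hx₀
    (by rw [heq]; exact h4.self_of_nhds.symm)
  rwa [h5.deriv, h6.hasDerivWithinAt.derivWithin ((uniqueDiffOn_Ici 0) x₀ hx₀.le)] at this

theorem IsViscSuperSol.interior (hv : IsViscSuperSol T H p₀ v)
    (hgr : ∀ β t x, t ∈ Ioo 0 T → 0 ≤ x → -v β t x ≤ A + K * x)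
    {α : Fin N} {t₀ x₀ a p : ℝ} (ht₀ : t₀ ∈ Ioo 0 T) (hx₀ : 0 < x₀) {φ : ℝ × ℝ → ℝ}
    (hφ : ContDiff ℝ 1 φ) (ha : HasDerivAt (fun s => φ (s, x₀)) a t₀)
    (hp : HasDerivAt (fun y => φ (t₀, y)) p x₀)
    (hle : ∀ᶠ z in nhds (t₀, x₀), φ z ≤ v α z.1 z.2) (heq : v α t₀ x₀ = φ (t₀, x₀)) :
    0 ≤ a + H α p := by
  obtain ⟨Φ, h1, h2, h3, h4⟩ := exists_test_above_interior (v := fun β t x => -v β t x) hgr hx₀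
    hφ.neg (hle.mono fun z hz => neg_le_neg hz)
  obtain ⟨h5, h6⟩ := hasDerivAt_slices_of_eventuallyEq (φ := fun z => -φ z) h4 ha.neg hp.neg
  have := (hv.2.2 (fun β t x => -Φ β t x) (fun β => (h1 β).neg.contDiffOn)
    (fun β γ t => by simp only [h2 β γ t])
    (fun β t x ht hx => neg_le.1 (h3 β t x ht hx))).1 α t₀ x₀ ht₀ hx₀
    (by have := h4.self_of_nhds; simp only at this; rw [heq, this, neg_neg])
  rw [h5.fun_neg.deriv,
    h6.fun_neg.hasDerivWithinAt.derivWithin ((uniqueDiffOn_Ici 0) x₀ hx₀.le)] at this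
  simpa using this

theorem IsViscSuperSol.junction (hN : 1 ≤ N) (hv : IsViscSuperSol T H p₀ v)
    (hgr : ∀ β t x, t ∈ Ioo 0 T → 0 ≤ x → -v β t x ≤ A + K * x)
    {t₀ a : ℝ} (ht₀ : t₀ ∈ Ioo 0 T) {g : ℝ → ℝ} {P : Fin N → ℝ}
    (hg : ContDiff ℝ 1 g) (ha : HasDerivAt g a t₀)
    (hle : ∀ β, ∀ᶠ z in nhdsWithin (t₀, 0) (univ ×ˢ Ici 0), g z.1 + P β * z.2 ≤ v β z.1 z.2)
    (heq : ∀ β, v β t₀ 0 = g t₀) :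
    ∃ β, 0 ≤ a + Hm (H β) (p₀ β) (P β) := by
  have : Nonempty (Fin N) := ⟨⟨0, hN⟩⟩
  obtain ⟨Φ, h1, h2, h3, h4⟩ := exists_test_above_junction (v := fun β t x => -v β t x) hgr
    (φ := fun β z => -(g z.1 + P β * z.2)) (fun β => by fun_prop) (fun β γ t => by simp)
    (fun β => (hle β).mono fun z hz => neg_le_neg hz)
  have h56 := fun β => hasDerivAt_slices_of_eventuallyEq (a := -a) (p := -P β) (h4 β)
    (by simpa using ha.fun_neg)
    (by simpa using ((((hasDerivAt_id (0 : ℝ)).const_mul (P β)).const_add (g t₀))).fun_neg)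
  have := (hv.2.2 (fun β t x => -Φ β t x) (fun β => (h1 β).neg.contDiffOn)
    (fun β γ t => by simp only [h2 β γ t])
    (fun β t x ht hx => neg_le.1 (h3 β t x ht hx))).2 t₀ ht₀
    (fun β => by have := (h4 β).self_of_nhds; simp only at this; rw [heq, this]; ring)
    (Classical.arbitrary _)
  rw [(h56 _).1.fun_neg.deriv] at this
  obtain ⟨β, hβ⟩ := (range_nonempty _).csSup_mem (Set.finite_range fun β : Fin N =>
    Hm (H β) (p₀ β) (derivWithin (fun y => -Φ β t₀ y) (Ici 0) 0))
  rw [← hβ] at this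
  refine ⟨β, ?_⟩
  simp only at this
  rw [(h56 β).2.fun_neg.hasDerivWithinAt.derivWithin ((uniqueDiffOn_Ici 0) 0 self_mem_Ici)] at this
  simpa using this

end Tests

section Subsolution

variable {N : ℕ} {L H : Fin N → ℝ → ℝ} {p₀ : Fin N → ℝ} {T A K : ℝ} {v : Fin N → ℝ → ℝ → ℝ}

theorem IsViscSubSol.le_action_interior (hH : IsTransform L H p₀) (hv : IsViscSubSol T H p₀ v)
    (hgr : ∀ β t x, t ∈ Ioo 0 T → 0 ≤ x → v β t x ≤ A + K * x)
    (hc : ∀ α, ContinuousOn (fun z : ℝ × ℝ => v α z.1 z.2) (Ico 0 T ×ˢ Ici 0))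
    {α : Fin N} {s t y x : ℝ} (hs : 0 < s) (hst : s < t) (htT : t < T) (hy : 0 < y) (hx : 0 < x) :
    v α t x ≤ v α s y + (t - s) * L α ((x - y) / (t - s)) := by
  by_contra! hlt
  set q := (x - y) / (t - s) with hq
  have hts : 0 < t - s := sub_pos.2 hst
  have hqt : q * (t - s) = x - y := div_mul_cancel₀ _ hts.ne'
  set X : ℝ → ℝ := fun σ => y + q * (σ - s) with hX
  have hXs : X s = y := by simp [hX]
  have hXt : X t = x := by simp only [hX]; linarith
  have hXc : Continuous X := by fun_prop
  obtain ⟨t₂, ht₂, ht₂T, hXt₂⟩ : ∃ t₂, t < t₂ ∧ t₂ < T ∧ 0 < X t₂ := by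
    have h1 : ∀ᶠ τ in nhdsWithin t (Ioi t), 0 < X τ :=
      nhdsWithin_le_nhds (hXc.continuousAt.eventually (lt_mem_nhds (by rw [hXt]; exact hx)))
    have h2 : ∀ᶠ τ in nhdsWithin t (Ioi t), τ < T := nhdsWithin_le_nhds (gt_mem_nhds htT)
    obtain ⟨τ, h1, h2, h3⟩ := (h1.and (h2.and self_mem_nhdsWithin)).exists
    exact ⟨τ, h3, h2, h1⟩
  obtain ⟨d₀, hd₀, hXd⟩ : ∃ d₀, 0 < d₀ ∧ ∀ σ ∈ Icc s t₂, d₀ < X σ := by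
    refine ⟨min y (X t₂) / 2, by positivity, fun σ hσ => ?_⟩
    have h3 : min y (X t₂) / 2 < min y (X t₂) := half_lt_self (by positivity)
    refine h3.trans_le ?_
    rcases le_total 0 q with h | h
    · refine (min_le_left _ _).trans ?_
      simp only [hX]
      nlinarith [mul_nonneg h (sub_nonneg.2 hσ.1)]
    · refine (min_le_right _ _).trans ?_
      simp only [hX]
      nlinarith [mul_nonneg (neg_nonneg.2 h) (sub_nonneg.2 hσ.2)]
  set F : ℝ × ℝ → ℝ := fun z => v α z.1 (X z.1 + z.2) with hF
  have hFc : ContinuousOn F (Icc s t₂ ×ˢ Icc (-d₀) d₀) := by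
    refine (hc α).comp (f := fun z : ℝ × ℝ => (z.1, X z.1 + z.2)) (by fun_prop) ?_
    rintro ⟨σ, z⟩ ⟨h1, h2⟩
    simp only at h1 h2
    refine ⟨⟨hs.le.trans h1.1, h1.2.trans_lt ht₂T⟩, ?_⟩
    have := hXd σ h1
    simp only [mem_Ici]
    linarith [h2.1]
  obtain ⟨M, hM⟩ := (isCompact_Icc.prod isCompact_Icc).exists_bound_of_continuousOn hFc
  set ℓ := L α q with hℓ
  set e := v α t x - (v α s y + (t - s) * ℓ) with he
  have he0 : 0 < e := sub_pos.2 hlt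
  set ρ := e / (4 * (t - s)) with hρ
  have hρ0 : 0 < ρ := by positivity
  have hρt : ρ * (t - s) = e / 4 := by rw [hρ]; field_simp
  have hst₂ : s < t₂ := hst.trans ht₂
  obtain ⟨d, hd, hdd, hFs⟩ : ∃ d, 0 < d ∧ d ≤ d₀ ∧ ∀ z, |z| ≤ d → F (s, z) < F (s, 0) + e / 4 := by
    have h1 : ContinuousWithinAt (fun z => F (s, z)) (Icc (-d₀) d₀) 0 := by
      refine ContinuousOn.continuousWithinAt ?_ ⟨by linarith, hd₀.le⟩
      exact hFc.comp (f := fun z => (s, z)) (by fun_prop) fun z hz => ⟨⟨le_rfl, hst₂.le⟩, hz⟩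
    have h2 := h1.eventually (gt_mem_nhds (show F (s, 0) < F (s, 0) + e / 4 by linarith))
    rw [nhdsWithin_eq_nhds.2 (Icc_mem_nhds (by linarith) hd₀), Metric.eventually_nhds_iff] at h2
    obtain ⟨δ, hδ, h2⟩ := h2
    refine ⟨min (δ / 2) d₀, by positivity, min_le_right _ _, fun z hz => h2 ?_⟩
    rw [Real.dist_eq, sub_zero]
    have := min_le_left (δ / 2) d₀
    linarith
  set D := 2 * M + |ℓ + ρ| * (t₂ - s) with hD
  have hD0 : ∀ σ ∈ Icc s t₂, -((ℓ + ρ) * (σ - s)) ≤ |ℓ + ρ| * (t₂ - s) := fun σ hσ => by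
    refine (neg_le_abs _).trans ?_
    rw [abs_mul, abs_of_nonneg (sub_nonneg.2 hσ.1)]
    gcongr
    exact hσ.2
  have hM' : ∀ σ ∈ Icc s t₂, ∀ z ∈ Icc (-d) d, |F (σ, z)| ≤ M := fun σ hσ z hz =>
    hM (σ, z) ⟨hσ, by linarith [hz.1], by linarith [hz.2]⟩
  obtain ⟨n, hn⟩ : ∃ n : ℝ, 0 < n ∧ D < e / 4 * (n * (t₂ - t)) := by
    have h1 : 0 < e / 4 * (t₂ - t) := mul_pos (by linarith) (by linarith)
    refine ⟨(|D| + 1) / (e / 4 * (t₂ - t)), by positivity, ?_⟩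
    have : e / 4 * ((|D| + 1) / (e / 4 * (t₂ - t)) * (t₂ - t)) = |D| + 1 := by
      have := sub_pos.2 ht₂
      field_simp
    linarith [le_abs_self D]
  obtain ⟨k, hk⟩ : ∃ k : ℝ, D < k * d ^ 2 := by
    refine ⟨(D + 1) / d ^ 2, ?_⟩
    rw [div_mul_cancel₀ _ (by positivity)]
    linarith
  set G : ℝ × ℝ → ℝ := fun z => F z - ((ℓ + ρ) * (z.1 - s) + e / 4 * Real.exp (n * (z.1 - t)))
    - k * z.2 ^ 2 with hG
  have hGc : ContinuousOn G (Icc s t₂ ×ˢ Icc (-d) d) := by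
    have := hFc.mono (prod_mono_right (Icc_subset_Icc (neg_le_neg hdd) hdd) :
      Icc s t₂ ×ˢ Icc (-d) d ⊆ _)
    fun_prop
  have hmem : (t, (0 : ℝ)) ∈ Icc s t₂ ×ˢ Icc (-d) d :=
    ⟨⟨hst.le, ht₂.le⟩, by simp only [mem_Icc]; constructor <;> linarith⟩
  obtain ⟨⟨σ, z⟩, ⟨hσ, hz⟩, hmax⟩ :=
    (isCompact_Icc.prod isCompact_Icc).exists_isMaxOn ⟨_, hmem⟩ hGc
  simp only at hσ hz
  have hmax' : ∀ τ ∈ Icc s t₂, ∀ w ∈ Icc (-d) d, G (τ, w) ≤ G (σ, z) := fun τ hτ w hw =>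
    hmax (show (τ, w) ∈ Icc s t₂ ×ˢ Icc (-d) d from ⟨hτ, hw⟩)
  have hFs0 : F (s, 0) = v α s y := by simp [hF, hXs]
  have hGt : F (s, 0) + e / 2 ≤ G (σ, z) := by
    refine le_trans (le_of_eq ?_) (hmax' t hmem.1 0 hmem.2)
    have hFt : F (t, 0) = v α t x := by simp [hF, hXt]
    simp only [hG, hFt, hFs0, sub_self, mul_zero, Real.exp_zero]
    linarith
  have hFs1 : -M ≤ F (s, 0) := (abs_le.1 (hM' s ⟨le_rfl, hst₂.le⟩ 0 hmem.2)).1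
  have hFz := (abs_le.1 (hM' σ hσ z hz)).2
  have hGz : G (σ, z) = F (σ, z) - ((ℓ + ρ) * (σ - s) + e / 4 * Real.exp (n * (σ - t)))
    - k * z ^ 2 := rfl
  have hexp := Real.exp_pos (n * (σ - t))
  have hexp' : 0 < e / 4 * Real.exp (n * (σ - t)) := by positivity
  have hk0 : 0 < k := by
    have : 0 ≤ M := (abs_nonneg _).trans (hM' σ hσ z hz)
    have : 0 ≤ D := by
      have := mul_nonneg (abs_nonneg (ℓ + ρ)) (sub_nonneg.2 hst₂.le)
      linarith
    exact pos_of_mul_pos_left (this.trans_lt hk) (by positivity)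
  have hkz : 0 ≤ k * z ^ 2 := by positivity
  have hz1 : |z| < d := by
    refine lt_of_le_of_ne (abs_le.2 hz) fun h => ?_
    have : z ^ 2 = d ^ 2 := by rw [← h, sq_abs]
    rw [this] at hGz
    have := hD0 σ hσ
    linarith
  have hσ1 : s < σ := by
    refine lt_of_le_of_ne hσ.1 fun h => ?_
    subst h
    have := hFs z hz1.le
    rw [sub_self, mul_zero] at hGz
    linarith
  have hσ2 : σ < t₂ := by
    refine lt_of_le_of_ne hσ.2 fun h => ?_
    have := hD0 σ hσ
    rw [h] at hGt hGz hFz this hexp'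
    have h1 := Real.add_one_le_exp (n * (t₂ - t))
    have h2 : e / 4 * (n * (t₂ - t)) ≤ e / 4 * Real.exp (n * (t₂ - t)) := by gcongr; linarith
    linarith
  set φ : ℝ × ℝ → ℝ := fun w => G (σ, z) + ((ℓ + ρ) * (w.1 - s) + e / 4 * Real.exp (n * (w.1 - t)))
    + k * (w.2 - (y + q * (w.1 - s))) ^ 2 with hφ
  have hXz : 0 < X σ + z := by
    have := hXd σ hσ
    linarith [hz.1]
  have key := hv.interior hgr (α := α) (t₀ := σ) (x₀ := X σ + z) (φ := φ)
    (a := (ℓ + ρ) + e / 4 * (Real.exp (n * (σ - t)) * n) - 2 * k * q * z) (p := 2 * k * z)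
    ⟨hs.trans hσ1, hσ2.trans ht₂T⟩ hXz (by fun_prop) ?_ ?_ ?_ ?_
  · have h1 := hH.le_full α (2 * k * z) q
    have h2 : 0 < e / 4 * (Real.exp (n * (σ - t)) * n) := mul_pos (by linarith) (mul_pos hexp hn.1)
    nlinarith
  · have h1 : HasDerivAt (fun τ : ℝ => n * (τ - t)) n σ := by
      simpa using ((hasDerivAt_id σ).sub_const t).const_mul n
    have h2 : HasDerivAt (fun τ : ℝ => (ℓ + ρ) * (τ - s)) (ℓ + ρ) σ := by
      simpa using ((hasDerivAt_id σ).sub_const s).const_mul (ℓ + ρ)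
    have h3 : HasDerivAt (fun τ : ℝ => X σ + z - (y + q * (τ - s))) (-q) σ := by
      simpa using ((((hasDerivAt_id σ).sub_const s).const_mul q).const_add y).const_sub (X σ + z)
    have h4 := ((h2.add (h1.exp.const_mul (e / 4))).const_add (G (σ, z))).add
      ((h3.pow 2).const_mul k)
    refine h4.congr_deriv ?_
    simp only [hX]
    push_cast
    ring
  · have h3 : HasDerivAt (fun w : ℝ => w - (y + q * (σ - s))) 1 (X σ + z) :=
      (hasDerivAt_id _).sub_const _
    have h4 := ((h3.pow 2).const_mul k).const_add
      (G (σ, z) + ((ℓ + ρ) * (σ - s) + e / 4 * Real.exp (n * (σ - t))))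
    refine h4.congr_deriv ?_
    simp only [hX]
    push_cast
    ring
  · have h1 : ∀ᶠ w : ℝ × ℝ in nhds (σ, X σ + z), w.1 ∈ Icc s t₂ :=
      continuousAt_fst.eventually (Icc_mem_nhds hσ1 hσ2)
    have h2 : ∀ᶠ w : ℝ × ℝ in nhds (σ, X σ + z), w.2 - X w.1 ∈ Icc (-d) d := by
      have : ContinuousAt (fun w : ℝ × ℝ => w.2 - X w.1) (σ, X σ + z) := by fun_prop
      refine this.eventually (Icc_mem_nhds ?_ ?_)
      · simp only [add_sub_cancel_left]; exact (abs_lt.1 hz1).1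
      · simp only [add_sub_cancel_left]; exact (abs_lt.1 hz1).2
    filter_upwards [h1, h2] with w hw1 hw2
    have := hmax' w.1 hw1 _ hw2
    have h3 : G (w.1, w.2 - X w.1) = v α w.1 w.2 - ((ℓ + ρ) * (w.1 - s)
      + e / 4 * Real.exp (n * (w.1 - t))) - k * (w.2 - X w.1) ^ 2 := by
      simp only [hG, hF, add_sub_cancel]
    simp only [hφ]
    simp only [hX] at h3 this
    linarith
  · have : X σ + z - (y + q * (σ - s)) = z := by simp [hX]
    simp only [hφ, this]
    have h5 : F (σ, z) = v α σ (X σ + z) := rfl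
    linarith

theorem IsViscSubSol.actionSubOn (hH : IsTransform L H p₀) (hv : IsViscSubSol T H p₀ v)
    (hgr : ∀ β t x, t ∈ Ioo 0 T → 0 ≤ x → v β t x ≤ A + K * x)
    (hc : ∀ α, ContinuousOn (fun z : ℝ × ℝ => v α z.1 z.2) (Ico 0 T ×ˢ Ici 0)) :
    ActionSubOn L (Ico 0 T) v := by
  intro α s t y x hs ht hst hy hx
  have key : ∀ {r z : ℝ}, r ∈ Ico 0 T → 0 ≤ z →
      Tendsto (fun ε => v α (r + ε) (z + ε)) (nhdsWithin 0 (Ioi 0)) (nhds (v α r z)) := by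
    intro r z hr hz
    have h1 := hc α (r, z) ⟨hr, hz⟩
    refine h1.tendsto.comp (f := fun ε : ℝ => (r + ε, z + ε)) (tendsto_nhdsWithin_iff.2 ⟨?_, ?_⟩)
    · have : Continuous fun ε : ℝ => (r + ε, z + ε) := by fun_prop
      have := this.tendsto 0
      simp only [add_zero] at this
      exact this.mono_left nhdsWithin_le_nhds
    · have h2 : ∀ᶠ ε in nhdsWithin (0 : ℝ) (Ioi 0), ε < T - r :=
        nhdsWithin_le_nhds (gt_mem_nhds (sub_pos.2 hr.2))
      filter_upwards [h2, self_mem_nhdsWithin] with ε h3 h4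
      have h4 : 0 < ε := h4
      exact ⟨⟨by linarith [hr.1], by linarith⟩, by simp only [mem_Ici]; linarith⟩
  refine le_of_tendsto_of_tendsto (key ht hx) ((key hs hy).add_const _) ?_
  have h2 : ∀ᶠ ε in nhdsWithin (0 : ℝ) (Ioi 0), ε < T - t :=
    nhdsWithin_le_nhds (gt_mem_nhds (sub_pos.2 ht.2))
  filter_upwards [h2, self_mem_nhdsWithin] with ε h3 h4
  have h4 : 0 < ε := h4
  have := hv.le_action_interior hH hgr hc (α := α) (s := s + ε) (t := t + ε) (y := y + ε)
    (x := x + ε) (by linarith [hs.1]) (by linarith) (by linarith) (by linarith) (by linarith)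
  simpa only [add_sub_add_right_eq_sub] using this

end Subsolution

/-! ### Comparison with supersolutions -/

section Supersolution

variable {N : ℕ} {L H : Fin N → ℝ → ℝ} {p₀ : Fin N → ℝ} {T A B K R η : ℝ}
  {v w : Fin N → ℝ → ℝ → ℝ}

theorem IsViscSuperSol.add_time (hv : IsViscSuperSol T H p₀ v) {ψ : ℝ → ℝ} (hψ : ContDiff ℝ 1 ψ)
    (hψ' : ∀ t, 0 ≤ deriv ψ t) : IsViscSuperSol T H p₀ (fun α t x => v α t x + ψ t) := by
  have hψc := hψ.continuous
  have hsub : ∀ {φ : Fin N → ℝ → ℝ → ℝ} {α : Fin N} {t x : ℝ},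
      ContDiffOn ℝ 1 (fun q : ℝ × ℝ => φ α q.1 q.2) (Ioo 0 T ×ˢ Ici 0) → t ∈ Ioo 0 T → 0 ≤ x →
      deriv (fun s => φ α s x - ψ s) t ≤ deriv (fun s => φ α s x) t := by
    intro φ α t x hφ ht hx
    have h1 : ContDiffOn ℝ 1 (fun s => φ α s x) (Ioo 0 T) :=
      hφ.comp (f := fun s => (s, x)) (by fun_prop) fun s hs => ⟨hs, hx⟩
    have h2 : DifferentiableAt ℝ (fun s => φ α s x) t :=
      (h1.differentiableOn one_ne_zero).differentiableAt (isOpen_Ioo.mem_nhds ht)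
    rw [deriv_fun_sub h2 ((hψ.differentiable one_ne_zero) t)]
    linarith [hψ' t]
  refine ⟨fun α => (hv.1 α).add (Continuous.continuousOn
    (by fun_prop : Continuous fun q : ℝ × ℝ => ψ q.1)).lowerSemicontinuousOn,
    fun α β t => by simp only [hv.2.1 α β t], fun φ hφ hφ0 hle => ?_⟩
  have key := hv.2.2 (fun α t x => φ α t x - ψ t)
    (fun α => (hφ α).sub (ContDiff.contDiffOn (by fun_prop)))
    (fun α β t => by simp only [hφ0 α β t])
    (fun β t x ht hx => by linarith [hle β t x ht hx])
  simp only [derivWithin_sub_const_fun] at key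
  refine ⟨fun α t x ht hx heq => ?_, fun t ht heq α => ?_⟩
  · have := key.1 α t x ht hx (by linarith)
    linarith [hsub (hφ α) ht hx.le]
  · have := key.2 t ht (fun β => by linarith [heq β]) α
    linarith [hsub (hφ α) ht le_rfl]

theorem le_of_forall_le_add_mul {a b c r : ℝ} (hr : 0 < r)
    (h : ∀ τ, 0 < τ → τ ≤ r → a ≤ b + c * τ) : a ≤ b := by
  have h1 : Tendsto (fun τ : ℝ => b + c * τ) (nhdsWithin 0 (Ioi 0)) (nhds b) := by
    have : Continuous fun τ : ℝ => b + c * τ := by fun_prop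
    have := this.tendsto 0
    simp only [mul_zero, add_zero] at this
    exact this.mono_left nhdsWithin_le_nhds
  refine ge_of_tendsto h1 ?_
  filter_upwards [nhdsWithin_le_nhds (Iic_mem_nhds hr), self_mem_nhdsWithin] with τ h2 h3
  exact h τ h3 h2

/-- A Lipschitz function gaining at rate `η` along every action segment of speed at most `R`. -/
structure IsStrictAction (L : Fin N → ℝ → ℝ) (w : Fin N → ℝ → ℝ → ℝ) (K R η : ℝ) : Prop where
  K_nonneg : 0 ≤ K
  R_pos : 0 < R
  η_pos : 0 < η
  junction : ∀ α β t, w α t 0 = w β t 0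
  lip : ∀ α s t x y, 0 ≤ x → 0 ≤ y → |w α t x - w α s y| ≤ K * (|t - s| + |x - y|)
  action : ∀ α s τ y q, 0 < τ → 0 ≤ y → 0 ≤ y - q * τ → |q| ≤ R →
    w α s y ≤ w α (s - τ) (y - q * τ) + τ * (L α q - η)
  superlinear : ∀ α q, R ≤ |q| → (2 * K + 1) * |q| + L α 0 ≤ L α q

set_option maxHeartbeats 1000000 in
theorem IsStrictAction.no_interior_min (hw : IsStrictAction L w K R η) (hH : IsTransform L H p₀)
    (hv : IsViscSuperSol T H p₀ v)
    (hgr : ∀ β t x, t ∈ Ioo 0 T → 0 ≤ x → -v β t x ≤ A + B * x)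
    (hc : ∀ α, ContinuousOn (fun z : ℝ × ℝ => v α z.1 z.2) (Ico 0 T ×ˢ Ici 0))
    {α : Fin N} {t₀ s₀ x₀ k r₀ : ℝ} (ht₀ : t₀ ∈ Ioo 0 T) (hx₀ : 0 < x₀) (hr₀ : 0 < r₀)
    (hmin : ∀ t s x, |t - t₀| ≤ r₀ → |s - s₀| ≤ r₀ → |x - x₀| ≤ r₀ → 0 ≤ x →
      v α t₀ x₀ - w α s₀ x₀ + k * (t₀ - s₀) ^ 2 ≤ v α t x - w α s x + k * (t - s) ^ 2) :
    False := by
  have hK := hw.K_nonneg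
  have hR := hw.R_pos
  have hη := hw.η_pos
  obtain ⟨r, hr, hrr, hrx, hrt, hrT, hr1, hrη⟩ : ∃ r, 0 < r ∧ r ≤ r₀ ∧ 2 * r < x₀ ∧ r < t₀ ∧
      t₀ + r < T ∧ 2 * r ≤ 1 ∧ (4 + 2 * R) * r ≤ η / 2 := by
    have h : ∀ {a b : ℝ}, 0 < b → ∀ᶠ r in nhdsWithin (0 : ℝ) (Ioi 0), a * r < b := by
      intro a b hb
      have : Continuous fun r : ℝ => a * r := by fun_prop
      exact nhdsWithin_le_nhds (this.continuousAt.eventually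
        (gt_mem_nhds (by simpa using hb)))
    obtain ⟨r, h1, h2, h3, h4, h5, h6, h7⟩ := ((h (a := 1) hr₀).and ((h (a := 2) hx₀).and
      ((h (a := 1) ht₀.1).and ((h (a := 1) (sub_pos.2 ht₀.2)).and ((h (a := 2) one_pos).and
      ((h (a := 4 + 2 * R) (half_pos hη)).and self_mem_nhdsWithin)))))).exists
    exact ⟨r, h7, by linarith, by linarith, by linarith, by linarith, by linarith, by linarith⟩
  obtain ⟨j, hj, hjr, hjr2⟩ : ∃ j, 0 < j ∧ K < j * r ∧ K ^ 2 < j * r ^ 2 := by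
    refine ⟨(K ^ 2 + 1) / r ^ 2 + (K + 1) / r, by positivity, ?_, ?_⟩
    · have h1 : (K + 1) / r * r = K + 1 := div_mul_cancel₀ _ hr.ne'
      have h2 : 0 ≤ (K ^ 2 + 1) / r ^ 2 * r := by positivity
      rw [add_mul]
      linarith
    · have h1 : (K ^ 2 + 1) / r ^ 2 * r ^ 2 = K ^ 2 + 1 := div_mul_cancel₀ _ (by positivity)
      have h2 : 0 ≤ (K + 1) / r * r ^ 2 := by positivity
      rw [add_mul]
      linarith
  set Ψ : ℝ × ℝ × ℝ × ℝ → ℝ := fun z => v α z.1 z.2.2.1 - w α z.2.1 z.2.2.2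
    + k * (z.1 - z.2.1) ^ 2 + j * (z.2.2.1 - z.2.2.2) ^ 2
    + ((z.1 - t₀) ^ 2 + (z.2.1 - s₀) ^ 2 + (z.2.2.1 - x₀) ^ 2) with hΨ
  set Q : Set (ℝ × ℝ × ℝ × ℝ) := Icc (t₀ - r) (t₀ + r) ×ˢ Icc (s₀ - r) (s₀ + r) ×ˢ
    Icc (x₀ - r) (x₀ + r) ×ˢ Icc (x₀ - 2 * r) (x₀ + 2 * r) with hQ
  have hΨc : ContinuousOn Ψ Q := by
    have h1 : ContinuousOn (fun z : ℝ × ℝ × ℝ × ℝ => v α z.1 z.2.2.1) Q := by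
      refine (hc α).comp (f := fun z : ℝ × ℝ × ℝ × ℝ => (z.1, z.2.2.1)) (by fun_prop) ?_
      rintro z ⟨h1, h2, h3, h4⟩
      exact ⟨⟨by linarith [h1.1], by linarith [h1.2]⟩, by simp only [mem_Ici]; linarith [h3.1]⟩
    have h2 : ContinuousOn (fun z : ℝ × ℝ × ℝ × ℝ => w α z.2.1 z.2.2.2) Q := by
      refine (continuousOn_of_abs hK hw.lip α).comp
        (f := fun z : ℝ × ℝ × ℝ × ℝ => (z.2.1, z.2.2.2)) (by fun_prop) ?_
      rintro z ⟨h1, h2, h3, h4⟩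
      exact ⟨mem_univ _, by simp only [mem_Ici]; linarith [h4.1]⟩
    exact (((h1.sub h2).add (Continuous.continuousOn (by fun_prop))).add
      (Continuous.continuousOn (by fun_prop))).add (Continuous.continuousOn (by fun_prop))
  have hQc : IsCompact Q := isCompact_Icc.prod (isCompact_Icc.prod (isCompact_Icc.prod isCompact_Icc))
  have hmem : (t₀, s₀, x₀, x₀) ∈ Q := by
    simp only [hQ, mem_prod, mem_Icc]
    refine ⟨⟨?_, ?_⟩, ⟨?_, ?_⟩, ⟨?_, ?_⟩, ?_, ?_⟩ <;> linarith
  obtain ⟨⟨t, s, x, y⟩, hz, hzmin⟩ := hQc.exists_isMinOn ⟨_, hmem⟩ hΨc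
  have hzmin' : ∀ z ∈ Q, Ψ (t, s, x, y) ≤ Ψ z := fun z hz => hzmin hz
  obtain ⟨ht, hs, hx, hy⟩ : t ∈ Icc (t₀ - r) (t₀ + r) ∧ s ∈ Icc (s₀ - r) (s₀ + r) ∧
    x ∈ Icc (x₀ - r) (x₀ + r) ∧ y ∈ Icc (x₀ - 2 * r) (x₀ + 2 * r) := hz
  have hx0 : 0 < x := by linarith [hx.1]
  have hy0 : 0 < y := by linarith [hy.1]
  have h1 := hzmin' _ hmem
  have h2 := hmin t s x (abs_le.2 ⟨by linarith [ht.1], by linarith [ht.2]⟩)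
    (abs_le.2 ⟨by linarith [hs.1], by linarith [hs.2]⟩)
    (abs_le.2 ⟨by linarith [hx.1], by linarith [hx.2]⟩) hx0.le
  have h3 := (abs_le.1 (hw.lip α s s x y hx0.le hy0.le)).1
  rw [sub_self, abs_zero, zero_add] at h3
  simp only [hΨ, sub_self, ne_eq, OfNat.ofNat_ne_zero, not_false_eq_true, zero_pow, mul_zero,
    add_zero] at h1
  set d := |x - y| with hd
  have hd0 : 0 ≤ d := abs_nonneg _
  have hdsq : (x - y) ^ 2 = d ^ 2 := (sq_abs _).symm
  rw [hdsq] at h1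
  have hsq : (t - t₀) ^ 2 + (s - s₀) ^ 2 + (x - x₀) ^ 2 ≤ K * d - j * d ^ 2 := by linarith
  have hsq0 : 0 ≤ (t - t₀) ^ 2 + (s - s₀) ^ 2 + (x - x₀) ^ 2 := by positivity
  have hjd : j * d ≤ K := by
    rcases hd0.eq_or_lt with h | h
    · rw [← h]; simpa using hK
    · refine le_of_mul_le_mul_right ?_ h
      nlinarith
  have hdr : d < r := lt_of_mul_lt_mul_left (hjd.trans_lt hjr) hj.le
  have hsqr : (t - t₀) ^ 2 + (s - s₀) ^ 2 + (x - x₀) ^ 2 < r ^ 2 := by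
    refine lt_of_mul_lt_mul_left ?_ hj.le
    nlinarith [mul_le_mul_of_nonneg_left hsq hj.le, mul_le_mul_of_nonneg_left hjd hK,
      mul_nonneg hj.le (mul_nonneg hj.le (sq_nonneg d))]
  have htr : |t - t₀| < r := abs_lt_of_sq_lt_sq (by nlinarith [sq_nonneg (s - s₀), sq_nonneg (x - x₀)]) hr.le
  have hsr : |s - s₀| < r := abs_lt_of_sq_lt_sq (by nlinarith [sq_nonneg (t - t₀), sq_nonneg (x - x₀)]) hr.le
  have hxr : |x - x₀| < r := abs_lt_of_sq_lt_sq (by nlinarith [sq_nonneg (s - s₀), sq_nonneg (t - t₀)]) hr.le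
  rw [abs_lt] at htr hsr hxr
  have hyr : |y - x₀| < 2 * r := by
    have := abs_lt.1 (hd ▸ hdr)
    rw [abs_lt]
    constructor <;> linarith
  rw [abs_lt] at hyr
  set p := -(2 * j * (x - y)) - 2 * (x - x₀) with hp
  set a := -(2 * k * (t - s)) - 2 * (t - t₀) with ha
  have hact : ∀ q, |q| ≤ R → η - L α q ≤ 2 * k * (t - s) + 2 * j * q * (x - y) - 2 * (s - s₀) := by
    intro q hq
    obtain ⟨ρ, hρ, hρ1, hρ2⟩ : ∃ ρ, 0 < ρ ∧ ρ ≤ s - (s₀ - r) ∧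
        R * ρ ≤ min (y - (x₀ - 2 * r)) (x₀ + 2 * r - y) := by
      have h3 : 0 < min (y - (x₀ - 2 * r)) (x₀ + 2 * r - y) :=
        lt_min (by linarith) (by linarith)
      refine ⟨min (s - (s₀ - r)) (min (y - (x₀ - 2 * r)) (x₀ + 2 * r - y) / R),
        lt_min (by linarith) (by positivity), min_le_left _ _, ?_⟩
      rw [mul_comm, ← le_div_iff₀ hR]
      exact min_le_right _ _
    refine le_of_forall_le_add_mul (c := k + j * q ^ 2 + 1) hρ fun τ hτ hτρ => ?_
    have h4 : |q * τ| ≤ R * ρ := by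
      rw [abs_mul, abs_of_pos hτ]
      exact mul_le_mul hq hτρ hτ.le hR.le
    have h5 := abs_le.1 (h4.trans hρ2)
    have h6 := min_le_left (y - (x₀ - 2 * r)) (x₀ + 2 * r - y)
    have h7 := min_le_right (y - (x₀ - 2 * r)) (x₀ + 2 * r - y)
    have h8 := hzmin' (t, s - τ, x, y - q * τ) ⟨ht, ⟨by simp only; linarith, by simp only; linarith⟩, hx,
      ⟨by simp only; linarith, by simp only; linarith⟩⟩
    have h9 := hw.action α s τ y q hτ hy0.le (by linarith) hq
    simp only [hΨ] at h8
    refine le_of_mul_le_mul_left ?_ hτ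
    nlinarith
  have hfull : H α p ≤ -a - η / 2 := by
    have hsmall : ∀ q, |q| ≤ R → p * q - L α q ≤ -a - η / 2 := by
      intro q hq
      have h4 := hact q hq
      have h5 : -(q * (x - x₀)) ≤ R * r := by
        refine (neg_le_abs _).trans ?_
        rw [abs_mul]
        exact mul_le_mul hq (abs_le.2 ⟨by linarith, by linarith⟩) (abs_nonneg _) hR.le
      simp only [hp, ha]
      nlinarith
    refine hH.full_le α p _ fun q => ?_
    rcases le_total |q| R with hq | hq
    · exact hsmall q hq
    · have h4 := hsmall 0 (by simpa using hR.le)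
      have h5 := hw.superlinear α q hq
      have h6 : |p| ≤ 2 * K + 1 := by
        have e1 : |2 * j * (x - y)| ≤ 2 * K := by
          rw [abs_mul, abs_of_pos (by positivity : 0 < 2 * j)]
          linarith
        have e2 := abs_le.1 e1
        rw [abs_le]
        constructor <;> simp only [hp] <;> linarith
      have h7 : p * q ≤ (2 * K + 1) * |q| := by
        refine (le_abs_self _).trans ?_
        rw [abs_mul]
        gcongr
      linarith
  have := hv.interior hgr (α := α) (t₀ := t) (x₀ := x) (a := a) (p := p)
    (φ := fun z => v α t x + (k * (t - s) ^ 2 + j * (x - y) ^ 2 + (t - t₀) ^ 2 + (x - x₀) ^ 2)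
      - (k * (z.1 - s) ^ 2 + j * (z.2 - y) ^ 2 + (z.1 - t₀) ^ 2 + (z.2 - x₀) ^ 2))
    ⟨by linarith, by linarith⟩ hx0 (by fun_prop) ?_ ?_ ?_ ?_
  · linarith
  · have e1 := ((((((hasDerivAt_id t).sub_const s).pow 2).const_mul k).add_const
      (j * (x - y) ^ 2)).add (((hasDerivAt_id t).sub_const t₀).pow 2)).add_const ((x - x₀) ^ 2)
    refine (e1.const_sub _).congr_deriv ?_
    simp [ha]
    ring
  · have e1 := ((((((hasDerivAt_id x).sub_const y).pow 2).const_mul j).const_add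
      (k * (t - s) ^ 2)).add_const ((t - t₀) ^ 2)).add (((hasDerivAt_id x).sub_const x₀).pow 2)
    refine (e1.const_sub _).congr_deriv ?_
    simp [hp]
    ring
  · have e1 : ∀ᶠ z : ℝ × ℝ in nhds (t, x), z.1 ∈ Icc (t₀ - r) (t₀ + r) :=
      continuousAt_fst.eventually (Icc_mem_nhds (by simp only; linarith) (by simp only; linarith))
    have e2 : ∀ᶠ z : ℝ × ℝ in nhds (t, x), z.2 ∈ Icc (x₀ - r) (x₀ + r) :=
      continuousAt_snd.eventually (Icc_mem_nhds (by simp only; linarith) (by simp only; linarith))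
    filter_upwards [e1, e2] with z hz1 hz2
    have := hzmin' (z.1, s, z.2, y) ⟨hz1, hs, hz2, hy⟩
    simp only [hΨ] at this
    linarith
  · simp

end Supersolution

section Junction

variable {N : ℕ} {L H : Fin N → ℝ → ℝ} {p₀ : Fin N → ℝ} {T A B K R η : ℝ}
  {v w : Fin N → ℝ → ℝ → ℝ}

/-- At a junction minimum of `v - w` with doubled time, `v` lies above a test function of slope
`P` on the branch `β`, where `P` satisfies the junction inequality strictly. -/
theorem IsStrictAction.exists_slope (hw : IsStrictAction L w K R η) (hH : IsTransform L H p₀)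
    (hLc : ∀ α, Continuous (L α)) {β : Fin N} {t₀ s₀ k r : ℝ} (hr : 0 < r)
    (hmin : ∀ t s x, |t - t₀| ≤ r → |s - s₀| ≤ r → 0 ≤ x → x ≤ r →
      v β t₀ 0 - w β s₀ 0 + k * (t₀ - s₀) ^ 2 ≤ v β t x - w β s x + k * (t - s) ^ 2) :
    ∃ P, Hm (H β) (p₀ β) P ≤ 2 * k * (t₀ - s₀) - η / 2 ∧
      ∀ᶠ z : ℝ × ℝ in nhdsWithin (t₀, 0) (univ ×ˢ Ici 0),
        v β t₀ 0 + k * (t₀ - s₀) ^ 2 - k * (z.1 - s₀) ^ 2 + P * z.2 ≤ v β z.1 z.2 := by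
  have hK := hw.K_nonneg
  have hR := hw.R_pos
  have hη := hw.η_pos
  set b := 2 * k * (t₀ - s₀) with hb
  have hwait : η - L β 0 ≤ b := by
    refine le_of_forall_le_add_mul (c := k) hr fun τ hτ hτr => ?_
    have h1 := hmin t₀ (s₀ - τ) 0 (by simpa using hr.le)
      (by rw [sub_sub_cancel_left, abs_neg, abs_of_pos hτ]; exact hτr) le_rfl hr.le
    have h2 := hw.action β s₀ τ 0 0 hτ le_rfl (by simp) (by simpa using hR.le)
    simp only [zero_mul, sub_zero] at h2
    refine le_of_mul_le_mul_left ?_ hτ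
    nlinarith
  obtain ⟨r₁, hr₁, hr₁R, hsmall⟩ : ∃ r₁, 0 < r₁ ∧ r₁ ≤ R ∧
      ∀ ρ ∈ Icc 0 r₁, K * ρ - L β (-ρ) ≤ -L β 0 + η / 2 := by
    have h1 : ContinuousAt (fun ρ => K * ρ - L β (-ρ)) 0 := by
      have := hLc β
      fun_prop
    have h2 := h1.eventually (gt_mem_nhds
      (show K * 0 - L β (-0) < -L β 0 + η / 2 by simp; linarith))
    rw [Metric.eventually_nhds_iff] at h2
    obtain ⟨δ, hδ, h2⟩ := h2
    refine ⟨min (δ / 2) R, by positivity, min_le_right _ _, fun ρ hρ => (h2 ?_).le⟩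
    rw [Real.dist_eq, sub_zero, abs_of_nonneg hρ.1]
    linarith [hρ.2, min_le_left (δ / 2) R]
  set f : ℝ → ℝ := fun ρ => -(b - η / 2 + L β (-ρ)) / ρ with hf
  have hfc : ContinuousOn f (Icc r₁ R) := by
    have := hLc β
    refine ContinuousOn.div (Continuous.continuousOn (by fun_prop)) continuousOn_id ?_
    intro ρ hρ
    exact (hr₁.trans_le hρ.1).ne'
  obtain ⟨ρ, hρ, hρmax⟩ := isCompact_Icc.exists_isMaxOn ⟨r₁, le_rfl, hr₁R⟩ hfc
  have hρ0 : 0 < ρ := hr₁.trans_le hρ.1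
  refine ⟨max (-K) (f ρ), hH.minus_le _ _ _ fun q hq => ?_, ?_⟩
  · set P := max (-K) (f ρ) with hP
    have hPK : -K ≤ P := le_max_left _ _
    have hPq : P * q ≤ K * -q := by nlinarith
    rcases le_total (-q) r₁ with h1 | h1
    · have := hsmall (-q) ⟨by linarith, h1⟩
      rw [neg_neg] at this
      linarith
    rcases le_total (-q) R with h2 | h2
    · have h3 : f (-q) ≤ P := (hρmax ⟨h1, h2⟩ : f (-q) ≤ f ρ).trans (le_max_right _ _)
      have h4 : 0 < -q := hr₁.trans_le h1
      simp only [hf, neg_neg] at h3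
      rw [div_le_iff₀ h4] at h3
      linarith
    · have h3 := hw.superlinear β q (by rwa [abs_of_nonpos hq])
      rw [abs_of_nonpos hq] at h3
      nlinarith
  · have hx : ∀ᶠ z : ℝ × ℝ in nhdsWithin (t₀, 0) (univ ×ˢ Ici 0), 0 ≤ z.2 := by
      filter_upwards [self_mem_nhdsWithin] with z hz using hz.2
    have hnhds : ∀ {F : ℝ × ℝ → ℝ} {c : ℝ}, Continuous F → F (t₀, 0) < c →
        ∀ᶠ z : ℝ × ℝ in nhdsWithin (t₀, 0) (univ ×ˢ Ici 0), F z < c := fun hF hc =>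
      nhdsWithin_le_nhds (hF.continuousAt.eventually (gt_mem_nhds hc))
    filter_upwards [hx, hnhds (F := fun z => |z.1 - t₀|) (by fun_prop) (by simpa using hr),
      hnhds (F := fun z => z.2) (by fun_prop) hr,
      hnhds (F := fun z => z.2 / ρ) (by fun_prop) (by simpa using hr),
      hnhds (F := fun z => 2 * k * (z.1 - s₀) + k * (z.2 / ρ)) (c := b + η / 2) (by fun_prop)
        (by simp [hb]; linarith)] with z h1 h2 h3 h4 h5
    have hz0 : v β t₀ 0 + k * (t₀ - s₀) ^ 2 - k * (z.1 - s₀) ^ 2 + -K * z.2 ≤ v β z.1 z.2 := by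
      have h6 := hmin z.1 s₀ z.2 h2.le (by simpa using hr.le) h1 h3.le
      have h7 := (abs_le.1 (hw.lip β s₀ s₀ z.2 0 h1 le_rfl)).1
      rw [sub_self, abs_zero, zero_add, sub_zero, abs_of_nonneg h1] at h7
      linarith
    rcases max_choice (-K) (f ρ) with h | h <;> rw [h]
    · exact hz0
    rcases h1.eq_or_lt with h0 | h0
    · rw [← h0] at hz0 ⊢
      simpa using hz0
    set τ := z.2 / ρ with hτ
    have hτ0 : 0 < τ := by positivity
    have hτz : ρ * τ = z.2 := mul_div_cancel₀ _ hρ0.ne'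
    have h6 := hmin z.1 (s₀ - τ) z.2 h2.le
      (by rw [sub_sub_cancel_left, abs_neg, abs_of_pos hτ0]; exact h4.le) h1 h3.le
    have e : 0 - -ρ * τ = z.2 := by rw [← hτz]; ring
    have h7 := hw.action β s₀ τ 0 (-ρ) hτ0 le_rfl (by rw [e]; exact h1)
      (by rw [abs_neg, abs_of_pos hρ0]; exact hρ.2)
    rw [e] at h7
    have h8 : f ρ * z.2 = -(b - η / 2 + L β (-ρ)) * τ := by
      rw [← hτz, ← mul_assoc]
      simp only [hf]
      rw [div_mul_cancel₀ _ hρ0.ne']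
    rw [h8]
    nlinarith

theorem IsStrictAction.no_junction_min (hw : IsStrictAction L w K R η) (hN : 1 ≤ N)
    (hH : IsTransform L H p₀) (hLc : ∀ α, Continuous (L α)) (hv : IsViscSuperSol T H p₀ v)
    (hgr : ∀ β t x, t ∈ Ioo 0 T → 0 ≤ x → -v β t x ≤ A + B * x)
    {t₀ s₀ k r : ℝ} (ht₀ : t₀ ∈ Ioo 0 T) (hr : 0 < r)
    (hmin : ∀ β t s x, |t - t₀| ≤ r → |s - s₀| ≤ r → 0 ≤ x → x ≤ r →
      v β t₀ 0 - w β s₀ 0 + k * (t₀ - s₀) ^ 2 ≤ v β t x - w β s x + k * (t - s) ^ 2) :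
    False := by
  choose P hP hle using fun β => hw.exists_slope (v := v) hH hLc hr (hmin β)
  have := hw.η_pos
  have e := ((((hasDerivAt_id t₀).sub_const s₀).pow 2).const_mul k).const_sub
    (v ⟨0, hN⟩ t₀ 0 + k * (t₀ - s₀) ^ 2)
  obtain ⟨β, hβ⟩ := hv.junction hN hgr (a := -(2 * k * (t₀ - s₀))) (P := P) ht₀
    (g := fun t => v ⟨0, hN⟩ t₀ 0 + k * (t₀ - s₀) ^ 2 - k * (t - s₀) ^ 2) (by fun_prop)
    (e.congr_deriv (by simp; ring)) (fun β => by rw [hv.2.1 ⟨0, hN⟩ β t₀]; exact hle β)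
    (fun β => by rw [hv.2.1 β ⟨0, hN⟩ t₀]; ring)
  linarith [hP β]

/-- A supersolution lying above a strict action function on the boundary of a box lies above it
inside. -/
theorem IsStrictAction.le_of_boundary (hw : IsStrictAction L w K R η) (hN : 1 ≤ N)
    (hH : IsTransform L H p₀) (hLc : ∀ α, Continuous (L α)) (hv : IsViscSuperSol T H p₀ v)
    (hgr : ∀ β t x, t ∈ Ioo 0 T → 0 ≤ x → -v β t x ≤ A + B * x)
    (hc : ∀ α, ContinuousOn (fun z : ℝ × ℝ => v α z.1 z.2) (Ico 0 T ×ˢ Ici 0))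
    {T₂ X : ℝ} (hT₂ : T₂ < T) (h0 : ∀ β, ∀ x, 0 ≤ x → w β 0 x ≤ v β 0 x)
    (hT : ∀ β, ∀ x, 0 ≤ x → w β T₂ x ≤ v β T₂ x)
    (hX : ∀ β, ∀ t ∈ Icc 0 T₂, w β t X ≤ v β t X)
    {α : Fin N} {t x : ℝ} (ht : t ∈ Icc 0 T₂) (hx : x ∈ Icc 0 X) : w α t x ≤ v α t x := by
  have : Nonempty (Fin N) := ⟨⟨0, hN⟩⟩
  have hK := hw.K_nonneg
  by_contra! hlt
  set m := w α t x - v α t x with hm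
  have hm0 : 0 < m := sub_pos.2 hlt
  obtain ⟨k, hk, hkK, hkm⟩ : ∃ k, 0 < k ∧ K < k ∧ K ^ 2 < k * m := by
    refine ⟨(K ^ 2 + 1) / m + K + 1, by positivity, ?_, ?_⟩
    · have : 0 ≤ (K ^ 2 + 1) / m := by positivity
      linarith
    · rw [add_assoc, add_mul, div_mul_cancel₀ _ hm0.ne']
      have : 0 ≤ (K + 1) * m := by positivity
      linarith
  set Ψ : Fin N → ℝ × ℝ × ℝ → ℝ := fun β z => v β z.1 z.2.2 - w β z.2.1 z.2.2
    + k * (z.1 - z.2.1) ^ 2 with hΨ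
  set Q : Set (ℝ × ℝ × ℝ) := Icc 0 T₂ ×ˢ Icc (-1) (T₂ + 1) ×ˢ Icc 0 X with hQ
  have hΨc : ∀ β, ContinuousOn (Ψ β) Q := by
    intro β
    have h1 : ContinuousOn (fun z : ℝ × ℝ × ℝ => v β z.1 z.2.2) Q :=
      (hc β).comp (f := fun z : ℝ × ℝ × ℝ => (z.1, z.2.2)) (by fun_prop)
        fun z hz => ⟨⟨hz.1.1, hz.1.2.trans_lt hT₂⟩, hz.2.2.1⟩
    have h2 : ContinuousOn (fun z : ℝ × ℝ × ℝ => w β z.2.1 z.2.2) Q :=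
      (continuousOn_of_abs hK hw.lip β).comp (f := fun z : ℝ × ℝ × ℝ => (z.2.1, z.2.2))
        (by fun_prop) fun z hz => ⟨mem_univ _, hz.2.2.1⟩
    exact (h1.sub h2).add (Continuous.continuousOn (by fun_prop))
  have hQc : IsCompact Q := isCompact_Icc.prod (isCompact_Icc.prod isCompact_Icc)
  have hmem : (t, t, x) ∈ Q :=
    ⟨ht, ⟨by simp only; linarith [ht.1], by simp only; linarith [ht.2]⟩, hx⟩
  choose z hzQ hz using fun β => hQc.exists_isMinOn ⟨_, hmem⟩ (hΨc β)
  obtain ⟨γ, hγ⟩ := Finite.exists_min fun β => Ψ β (z β)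
  obtain ⟨t₀, s₀, x₀, hz₀, ht₀, hs₀, hx₀⟩ : ∃ t₀ s₀ x₀, z γ = (t₀, s₀, x₀) ∧ t₀ ∈ Icc 0 T₂ ∧
      s₀ ∈ Icc (-1) (T₂ + 1) ∧ x₀ ∈ Icc 0 X := ⟨_, _, _, rfl, hzQ γ⟩
  have hmin : ∀ β, ∀ t ∈ Icc 0 T₂, ∀ s ∈ Icc (-1) (T₂ + 1), ∀ x ∈ Icc 0 X,
      v γ t₀ x₀ - w γ s₀ x₀ + k * (t₀ - s₀) ^ 2 ≤ v β t x - w β s x + k * (t - s) ^ 2 := by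
    intro β t ht s hs x hx
    have h1 := hγ β
    rw [hz₀] at h1
    exact h1.trans (hz β (show (t, s, x) ∈ Q from ⟨ht, hs, hx⟩))
  have h1 := hmin α t ht t hmem.2.1 x hx
  rw [sub_self, zero_pow two_ne_zero, mul_zero, add_zero] at h1
  have h2 := hmin γ t₀ ht₀ t₀ ⟨by linarith [ht₀.1], by linarith [ht₀.2]⟩ x₀ hx₀
  rw [sub_self, zero_pow two_ne_zero, mul_zero, add_zero] at h2
  have h3 := (abs_le.1 (hw.lip γ s₀ t₀ x₀ x₀ hx₀.1 hx₀.1))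
  rw [sub_self, abs_zero, add_zero] at h3
  set d := |t₀ - s₀| with hd
  have hd0 : 0 ≤ d := abs_nonneg _
  rw [← sq_abs, ← hd] at h1 h2
  have hkd : k * d ≤ K := by
    rcases hd0.eq_or_lt with h | h
    · rw [← h]; simpa using hK
    · refine le_of_mul_le_mul_right ?_ h
      nlinarith
  have hd1 : d < 1 := lt_of_mul_lt_mul_left (by linarith) hk.le
  have hKd : K * d < m := by
    refine lt_of_mul_lt_mul_left ?_ hk.le
    nlinarith
  have hneg : v γ t₀ x₀ < w γ t₀ x₀ := by
    have : 0 ≤ k * d ^ 2 := by positivity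
    linarith
  have ht₀0 : 0 < t₀ := by
    refine lt_of_le_of_ne ht₀.1 fun h => ?_
    rw [← h] at hneg
    exact hneg.not_ge (h0 γ x₀ hx₀.1)
  have ht₀T : t₀ < T₂ := by
    refine lt_of_le_of_ne ht₀.2 fun h => ?_
    rw [h] at hneg
    exact hneg.not_ge (hT γ x₀ hx₀.1)
  have hx₀X : x₀ < X := by
    refine lt_of_le_of_ne hx₀.2 fun h => ?_
    rw [h] at hneg
    exact hneg.not_ge (hX γ t₀ ht₀)
  have hd' := abs_lt.1 (hd ▸ hd1)
  obtain ⟨r, hr, hr1, hr2, hr3, hr4⟩ : ∃ r, 0 < r ∧ r ≤ t₀ ∧ r ≤ T₂ - t₀ ∧ r ≤ X - x₀ ∧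
      r ≤ 1 - d :=
    ⟨min (min t₀ (T₂ - t₀)) (min (X - x₀) (1 - d)),
      lt_min (lt_min ht₀0 (by linarith)) (lt_min (by linarith) (by linarith)),
      (min_le_left _ _).trans (min_le_left _ _), (min_le_left _ _).trans (min_le_right _ _),
      (min_le_right _ _).trans (min_le_left _ _), (min_le_right _ _).trans (min_le_right _ _)⟩
  have hloc : ∀ β t s x, |t - t₀| ≤ r → |s - s₀| ≤ r → x ≤ x₀ + r → 0 ≤ x →
      v γ t₀ x₀ - w γ s₀ x₀ + k * (t₀ - s₀) ^ 2 ≤ v β t x - w β s x + k * (t - s) ^ 2 := by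
    intro β t s x ht hs hx hx'
    rw [abs_le] at ht hs
    have := abs_le.1 hd.ge
    exact hmin β t ⟨by linarith, by linarith⟩ s ⟨by linarith, by linarith⟩ x ⟨hx', by linarith⟩
  have ht₀' : t₀ ∈ Ioo 0 T := ⟨ht₀0, ht₀T.trans hT₂⟩
  rcases hx₀.1.eq_or_lt with h | h
  · subst h
    refine hw.no_junction_min hN hH hLc hv hgr (s₀ := s₀) (k := k) ht₀' hr
      fun β t s x ht hs hx hxr => ?_
    rw [hv.2.1 β γ, hw.junction β γ]
    exact hloc β t s x ht hs (by simpa using hxr) hx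
  · exact hw.no_interior_min hH hv hgr hc (α := γ) (s₀ := s₀) (k := k) ht₀' h hr
      fun t s x ht hs hx hy => hloc γ t s x ht hs (by linarith [(abs_le.1 hx).2]) hy

/-- Supersolutions within bounded distance of a Lipschitz action function lie above it. -/
theorem IsViscSuperSol.ge_of_actionSubOn {u : Fin N → ℝ → ℝ → ℝ} {C M : ℝ} (hN : 1 ≤ N)
    (hH : IsTransform L H p₀) (hLc : ∀ α, Continuous (L α))
    (hLs : ∀ a : ℝ, ∃ b, ∀ α q, a * |q| - b ≤ L α q) (hv : IsViscSuperSol T H p₀ v)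
    (hgr : ∀ β t x, t ∈ Ioo 0 T → 0 ≤ x → -v β t x ≤ A + B * x)
    (hc : ∀ α, ContinuousOn (fun z : ℝ × ℝ => v α z.1 z.2) (Ico 0 T ×ˢ Ici 0))
    (hu : ActionSubOn L univ u) (hu0 : ∀ α β t, u α t 0 = u β t 0) (hC : 0 ≤ C)
    (hlip : ∀ α s t x y, 0 ≤ x → 0 ≤ y → |u α t x - u α s y| ≤ C * (|t - s| + |x - y|))
    (h0 : ∀ α x, 0 ≤ x → u α 0 x ≤ v α 0 x)
    (hM : ∀ α t x, t ∈ Ico 0 T → 0 ≤ x → u α t x - v α t x ≤ M)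
    {α : Fin N} {t x : ℝ} (ht : t ∈ Ico 0 T) (hx : 0 ≤ x) : u α t x ≤ v α t x := by
  by_contra! hlt
  have hT : 0 < T := ht.1.trans_lt ht.2
  set ε := u α t x - v α t x with hε
  have hε0 : 0 < ε := sub_pos.2 hlt
  obtain ⟨η, hη, hη1, hηT⟩ : ∃ η, 0 < η ∧ η ≤ 1 ∧ 2 * η * T ≤ ε / 4 := by
    refine ⟨min 1 (ε / (8 * T)), by positivity, min_le_left _ _, ?_⟩
    have h1 : 2 * (ε / (8 * T)) * T = ε / 4 := by field_simp; norm_num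
    rw [← h1]
    gcongr
    exact min_le_right _ _
  obtain ⟨R, hR, hsup⟩ : ∃ R, 0 < R ∧
      ∀ α q, R ≤ |q| → (2 * (C + 2) + 1) * |q| + L α 0 ≤ L α q := by
    obtain ⟨b, hb⟩ := hLs (2 * (C + 2) + 2)
    have hfin : ∃ m, ∀ α, L α 0 ≤ m := by
      obtain ⟨m, hm⟩ := (finite_range fun α => L α 0).bddAbove
      exact ⟨m, fun α => hm (mem_range_self α)⟩
    obtain ⟨m, hm⟩ := hfin
    refine ⟨|b + m| + 1, by positivity, fun α q hq => ?_⟩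
    linarith [hb α q, hm α, le_abs_self (b + m)]
  obtain ⟨δ, hδ, hδ1, hδR, hδx⟩ : ∃ δ, 0 < δ ∧ δ ≤ 1 ∧ δ * R ≤ η ∧ δ * x ≤ ε / 4 := by
    refine ⟨min 1 (min (η / R) (ε / (4 * (x + 1)))), by positivity, min_le_left _ _, ?_, ?_⟩
    · rw [← le_div_iff₀ hR]
      exact (min_le_right _ _).trans (min_le_left _ _)
    · have h1 : ε / (4 * (x + 1)) * (x + 1) = ε / 4 := by field_simp
      rw [← h1]
      gcongr
      · exact (min_le_right _ _).trans (min_le_right _ _)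
      · linarith
  have hw : IsStrictAction L (fun α t x => u α t x - δ * x - 2 * η * t) (C + 2) R η := by
    refine ⟨by linarith, hR, hη, fun α β t => by simp only [hu0 α β t], ?_, ?_, hsup⟩
    · intro α s t x y hx hy
      have h1 := abs_le.1 (hlip α s t x y hx hy)
      have h2 : |δ * (x - y)| ≤ 2 * |x - y| := by
        rw [abs_mul, abs_of_pos hδ]
        gcongr
        linarith
      have h3 : |2 * η * (t - s)| ≤ 2 * |t - s| := by
        rw [abs_mul, abs_of_pos (by positivity)]
        gcongr
        linarith
      rw [abs_le] at h2 h3 ⊢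
      constructor <;> linarith
    · intro α s τ y q hτ hy hy' hq
      have h1 := hu α (s - τ) s (y - q * τ) y (mem_univ _) (mem_univ _) (by linarith) hy' hy
      rw [sub_sub_cancel, sub_sub_cancel, mul_div_cancel_right₀ _ hτ.ne'] at h1
      have h2 : -(δ * q * τ) ≤ η * τ := by
        rw [← neg_mul]
        gcongr
        refine le_trans ?_ hδR
        rw [← mul_neg]
        gcongr
        exact (neg_le_abs q).trans hq
      linarith
  have ht0 : 0 < t := by
    refine lt_of_le_of_ne ht.1 fun h => ?_
    rw [← h] at hlt
    exact hlt.not_ge (h0 α x hx)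
  obtain ⟨T₂, hT₂, hT₂T⟩ := exists_between ht.2
  have hM0 : 0 < M := hε0.trans_le (hM α t x ht hx)
  set n := M / (ε / 4 * (T₂ - t)) with hn
  have hTt := sub_pos.2 hT₂
  have hn0 : 0 < n := by positivity
  have hnM : ε / 4 * (n * (T₂ - t)) = M := by rw [hn]; field_simp
  set ψ : ℝ → ℝ := fun τ => ε / 4 * Real.exp (n * (τ - t)) with hψ
  have hψ0 : ∀ τ, 0 ≤ ψ τ := fun τ => by positivity
  have hψT : M ≤ ψ T₂ := by
    rw [← hnM]
    simp only [hψ]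
    gcongr
    linarith [Real.add_one_le_exp (n * (T₂ - t))]
  have hψc : ContDiff ℝ 1 ψ := by fun_prop
  have hψ' : ∀ τ, 0 ≤ deriv ψ τ := fun τ => by
    have h1 : HasDerivAt (fun τ : ℝ => n * (τ - t)) n τ := by
      simpa using ((hasDerivAt_id τ).sub_const t).const_mul n
    rw [(h1.exp.const_mul (ε / 4)).deriv]
    positivity
  have hδM : 0 ≤ M / δ := by positivity
  have key := hw.le_of_boundary hN hH hLc (hv.add_time hψc hψ') (A := A) (B := B)
    (fun β t x ht hx => by linarith [hgr β t x ht hx, hψ0 t])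
    (fun α => (hc α).add (Continuous.continuousOn
      (by fun_prop : Continuous fun q : ℝ × ℝ => ψ q.1)))
    (T₂ := T₂) (X := x + M / δ) hT₂T ?_ ?_ ?_ (α := α) (t := t) (x := x) ⟨ht.1, hT₂.le⟩
    ⟨hx, by linarith⟩
  · have h1 : ψ t = ε / 4 := by simp [hψ]
    have h2 : 2 * η * t ≤ 2 * η * T := by gcongr; exact ht.2.le
    linarith
  · intro β y hy
    have := mul_nonneg hδ.le hy
    linarith [h0 β y hy, hψ0 0]
  · intro β y hy
    have := mul_nonneg hδ.le hy
    have h1 : 0 ≤ 2 * η * T₂ := by have := ht0.trans hT₂; positivity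
    linarith [hM β T₂ y ⟨ht.1.trans hT₂.le, hT₂T⟩ hy]
  · intro β τ hτ
    have h1 : δ * (x + M / δ) = δ * x + M := by field_simp
    have h2 : 0 ≤ δ * x := by positivity
    have h3 : 0 ≤ 2 * η * τ := by have := hτ.1; positivity
    linarith [hM β τ (x + M / δ) ⟨hτ.1, hτ.2.trans_lt hT₂T⟩ (by linarith), hψ0 τ]

end Junction

/-! ### Uniformly convex Lagrangians -/

theorem quadratic_lower_bound {f : ℝ → ℝ} {γ : ℝ} (hf : ContDiff ℝ 2 f)
    (h : ∀ q, γ ≤ deriv (deriv f) q) (q : ℝ) : f 0 + deriv f 0 * q + γ / 2 * q ^ 2 ≤ f q := by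
  have hf1 : Differentiable ℝ f := hf.differentiable two_ne_zero
  have hf2 : Differentiable ℝ (deriv f) :=
    (contDiff_succ_iff_deriv (n := 1).1 hf).2.2.differentiable one_ne_zero
  set g : ℝ → ℝ := fun q => f q - γ / 2 * q ^ 2 with hg
  have hd : ∀ q, HasDerivAt g (deriv f q - γ * q) q := fun q => by
    refine ((hf1 q).hasDerivAt.sub ((hasDerivAt_pow 2 q).const_mul (γ / 2))).congr_deriv ?_
    push_cast
    ring
  have hdg : deriv g = fun q => deriv f q - γ * q := funext fun q => (hd q).deriv
  have hconv : ConvexOn ℝ univ g := by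
    refine convexOn_univ_of_deriv2_nonneg (fun q => (hd q).differentiableAt) ?_ fun q => ?_
    · rw [hdg]
      fun_prop
    · have e : HasDerivAt (fun q => deriv f q - γ * q) (deriv (deriv f) q - γ) q :=
        ((hf2 q).hasDerivAt.sub ((hasDerivAt_id q).const_mul γ)).congr_deriv (by rw [mul_one])
      simp only [Function.iterate_succ, Function.iterate_zero, Function.comp_apply, id]
      rw [hdg, e.deriv]
      linarith [h q]
  have h0 := hd 0
  have hg0 : g 0 = f 0 := by simp [hg]
  have hgq : g q = f q - γ / 2 * q ^ 2 := rfl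
  rcases lt_trichotomy q 0 with hq | rfl | hq
  · have := hconv.slope_le_of_hasDerivAt (mem_univ q) (mem_univ 0) hq h0
    rw [slope_def_field, div_le_iff₀ (by linarith)] at this
    linarith
  · simp
  · have := hconv.le_slope_of_hasDerivAt (mem_univ 0) (mem_univ q) hq h0
    rw [slope_def_field, le_div_iff₀ (by linarith)] at this
    linarith

theorem exists_superlinear_bound {N : ℕ} {L : Fin N → ℝ → ℝ} {γ : ℝ} (hγ : 0 < γ)
    (hL : ∀ α, ContDiff ℝ 2 (L α)) (h : ∀ α q, γ ≤ deriv (deriv (L α)) q) (a : ℝ) :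
    ∃ b, ∀ α q, a * |q| - b ≤ L α q := by
  obtain ⟨b, hb⟩ := (finite_range fun α =>
    (a + |deriv (L α) 0|) ^ 2 / (2 * γ) - L α 0).bddAbove
  refine ⟨b, fun α q => ?_⟩
  have h1 := hb (mem_range_self α)
  have h2 := quadratic_lower_bound (hL α) (h α) q
  set c := deriv (L α) 0
  have h3 : -(c * q) ≤ |c| * |q| := (neg_le_abs _).trans (abs_mul c q).le
  have h4 : (a + |c|) * |q| ≤ γ / 2 * q ^ 2 + (a + |c|) ^ 2 / (2 * γ) := by
    have e : γ / 2 * q ^ 2 + (a + |c|) ^ 2 / (2 * γ) - (a + |c|) * |q|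
        = (γ * |q| - (a + |c|)) ^ 2 / (2 * γ) := by
      rw [← sq_abs q]
      field_simp
      ring
    have : 0 ≤ (γ * |q| - (a + |c|)) ^ 2 / (2 * γ) := by positivity
    linarith
  linarith

theorem isTransform_of_sSup {N : ℕ} {L H : Fin N → ℝ → ℝ} {p₀ : Fin N → ℝ}
    (hL : ∀ a : ℝ, ∃ b, ∀ α q, a * |q| - b ≤ L α q)
    (hH : ∀ α p, H α p = sSup (range fun q : ℝ => p * q - L α q))
    (hHm : ∀ α p, Hm (H α) (p₀ α) p = sSup ((fun q : ℝ => p * q - L α q) '' Iic 0)) :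
    IsTransform L H p₀ where
  le_full α p q := by
    rw [hH]
    refine le_csSup ?_ (mem_range_self q)
    obtain ⟨b, hb⟩ := hL |p|
    refine ⟨b, ?_⟩
    rintro _ ⟨r, rfl⟩
    have h1 : p * r ≤ |p| * |r| := (le_abs_self _).trans (abs_mul p r).le
    simp only
    linarith [hb α r]
  full_le α p c h := by
    rw [hH]
    refine csSup_le (range_nonempty _) ?_
    rintro _ ⟨q, rfl⟩
    exact h q
  minus_le α p c h := by
    rw [hHm]
    refine csSup_le (nonempty_Iic.image _) ?_
    rintro _ ⟨q, hq, rfl⟩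
    exact h q hq

/-- **Existence and uniqueness for the Hamilton–Jacobi problem on a junction**
(Theorem 2.8, from [IMZ]). Assume (A0)-(A1′) and let `T > 0`. Then there exists a unique
viscosity solution `u` of (HJ)-(CI) on `[0,T) × J` satisfying `|u(t,y) − u₀(y)| ≤ C_T`
for some constant `C_T > 0`; moreover `u` is Lipschitz continuous in `(t,y)` on
`(0,T) × J`. -/
theorem existence_uniqueness_HJ_junction {N : ℕ} (hN : 1 ≤ N)
    (H : Fin N → ℝ → ℝ) (p₀ : Fin N → ℝ)
    (hA1 : ∀ α, A1cond (H α) (p₀ α))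
    (hA1' : A1primeCond H p₀)
    (u₀ : Fin N → ℝ → ℝ) (hA0 : A0cond u₀)
    (T : ℝ) (hT : 0 < T) :
    ∃ u : Fin N → ℝ → ℝ → ℝ,
      IsViscSolCI T H p₀ u₀ u ∧
      (∃ C : ℝ, 0 < C ∧ ∀ (α : Fin N) (t x : ℝ), t ∈ Ico 0 T → 0 ≤ x →
        |u α t x - u₀ α x| ≤ C) ∧
      (∃ K : NNReal, ∀ α : Fin N,
        LipschitzOnWith K (fun q : ℝ × ℝ => u α q.1 q.2) (Ioo 0 T ×ˢ Ici 0)) ∧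
      (∀ v : Fin N → ℝ → ℝ → ℝ,
        IsViscSolCI T H p₀ u₀ v →
        (∃ C : ℝ, 0 < C ∧ ∀ (α : Fin N) (t x : ℝ), t ∈ Ico 0 T → 0 ≤ x →
          |v α t x - u₀ α x| ≤ C) →
        ∀ (α : Fin N) (t x : ℝ), t ∈ Ico 0 T → 0 ≤ x → v α t x = u α t x) := by
  obtain ⟨γ, L, hγ, hL2, hLγ, hHL, hHmL, -⟩ := hA1'
  have hLs := exists_superlinear_bound hγ hL2 hLγ
  have hLc : ∀ α, Continuous (L α) := fun α => (hL2 α).continuous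
  have hH := isTransform_of_sSup (p₀ := p₀) hLs hHL hHmL
  have hHc : ∀ α, Continuous (H α) := fun α => (hA1 α).1.continuous
  obtain ⟨K, hK0, hK⟩ : ∃ K : ℝ, 0 ≤ K ∧
      ∀ α x y, 0 ≤ x → 0 ≤ y → |u₀ α x - u₀ α y| ≤ K * |x - y| := by
    choose c hc using hA0.1
    obtain ⟨m, hm⟩ := (finite_range c).bddAbove
    refine ⟨m, m.2, fun α x y hx hy => ?_⟩
    have h1 := (hc α).dist_le_mul x hx y hy
    rw [Real.dist_eq, Real.dist_eq] at h1
    refine h1.trans ?_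
    gcongr
    exact hm (mem_range_self α)
  obtain ⟨u, hu, hu0, hui, ⟨C, hC, hlip⟩, hmax⟩ := exists_valueFn hA0.2 hK hLs
  have huc := continuousOn_of_abs hC hlip
  have hut : ∀ α t x, t ∈ Ico 0 T → 0 ≤ x → |u α t x - u₀ α x| ≤ C * T := by
    intro α t x ht hx
    have h1 := hlip α 0 t x x hx hx
    rw [hui, sub_self, abs_zero, add_zero, sub_zero, abs_of_nonneg ht.1] at h1
    exact h1.trans (by gcongr; exact ht.2.le)
  refine ⟨u, ⟨⟨value_isViscSubSol hN hH hu hu0 huc, fun α x _ => (hui α x).le⟩,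
    value_isViscSuperSol hH hHc hu hu0 huc ?_, fun α x _ => (hui α x).ge⟩,
    ⟨C * T + 1, by positivity, fun α t x ht hx => by linarith [hut α t x ht hx]⟩,
    ⟨_, fun α => (lipschitzOnWith_of_abs hC hlip α).mono (prod_mono_left (subset_univ _))⟩, ?_⟩
  · intro f hf hf0 hfi
    exact hmax T f hf hf0 fun α x hx => by simpa only [hui] using hfi α x hx
  rintro v ⟨⟨hsub, hsubi⟩, hsup, hsupi⟩ ⟨M, hM, hvM⟩ α t x ht hx
  have hvc : ∀ α, ContinuousOn (fun z : ℝ × ℝ => v α z.1 z.2) (Ico 0 T ×ˢ Ici 0) := fun α =>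
    continuousOn_iff_lower_upperSemicontinuousOn.2 ⟨hsup.1 α, hsub.1 α⟩
  obtain ⟨m, hm⟩ := (finite_range fun α => |u₀ α 0|).bddAbove
  have hgr : ∀ β t x, t ∈ Ioo 0 T → 0 ≤ x → |v β t x| ≤ M + m + K * x := by
    intro β t x ht hx
    have h1 := abs_le.1 (hvM β t x ⟨ht.1.le, ht.2⟩ hx)
    have h2 := hK β x 0 hx le_rfl
    rw [sub_zero, abs_of_nonneg hx, abs_le] at h2
    have h3 := abs_le.1 (hm (mem_range_self β))
    rw [abs_le]
    constructor <;> linarith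
  refine le_antisymm (hmax T v (hsub.actionSubOn hH
    (fun β t x ht hx => (le_abs_self _).trans (hgr β t x ht hx)) hvc)
    (fun α β t _ => hsub.2.1 α β t) hsubi α t x ht hx) ?_
  refine hsup.ge_of_actionSubOn (M := C * T + M) hN hH hLc hLs
    (fun β t x ht hx => (neg_le_abs _).trans (hgr β t x ht hx)) hvc hu hu0 hC hlip
    (fun β y hy => by rw [hui]; exact hsupi β y hy) (fun β s y hs hy => ?_) ht hx
  linarith [(abs_le.1 (hut β s y hs hy)).2, (abs_le.1 (hvM β s y hs hy)).1]
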